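/- arXiv:1105.2042 — 3 statements merged into one kernel-verified Lean document; each statement's English description precedes it below -/
import Mathlib

section
/- For every positive integer n, the value ζ(2n) = Σ_{k=1}^∞ 1/k^{2n} of the Riemann zeta function at the even positive integer 2n is an irrational number. -/
open Polynomial in
/-- If `D` clears the denominators of the members of a Galois-stable multiset `s`, then `D ^ m`
clears the denominator of the rational number `∑ x ∈ s, g x`, for `g` integral of degree at most
`m`. -/
theorem exists_intCast_eq_pow_mul_sum_aeval {K : Type*} [Field K] [Algebra ℚ K] [IsGalois ℚ K]
    {s : Multiset K} (hs : ∀ σ : Gal(K/ℚ), s.map σ = s) {D : ℤ}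
    (hD : ∀ x ∈ s, IsIntegral ℤ (D • x)) {g : ℤ[X]} {m : ℕ} (hg : g.natDegree ≤ m) :
    ∃ M : ℤ, (M : K) = (D : K) ^ m * (s.map fun x ↦ aeval x g).sum := by
  have hint : IsIntegral ℤ ((D : K) ^ m * (s.map fun x ↦ aeval x g).sum) := by
    rw [← Multiset.sum_map_mul_left]
    refine IsIntegral.multiset_sum fun y hy ↦ ?_
    obtain ⟨x, hx, rfl⟩ := Multiset.mem_map.mp hy
    rw [aeval_eq_sum_range' (Nat.lt_succ_of_le hg), Finset.mul_sum]
    refine IsIntegral.sum _ fun i hi ↦ ?_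
    have hi : i ≤ m := Nat.lt_succ_iff.mp (Finset.mem_range.mp hi)
    have : (D : K) ^ m * g.coeff i • x ^ i =
        ((D ^ (m - i) * g.coeff i : ℤ) : K) * (D • x) ^ i := by
      rw [← Nat.sub_add_cancel hi, zsmul_eq_mul, zsmul_eq_mul]
      push_cast
      rw [Nat.add_sub_cancel, mul_pow]
      ring
    rw [this]
    exact (isIntegral_algebraMap (R := ℤ) (A := K)).mul ((hD x hx).pow i)
  have hfix : (D : K) ^ m * (s.map fun x ↦ aeval x g).sum ∈ Set.range (algebraMap ℚ K) := by
    rw [InfiniteGalois.mem_range_algebraMap_iff_fixed]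
    intro σ
    rw [map_mul, map_pow, map_intCast, map_multiset_sum, Multiset.map_map]
    conv_rhs => rw [← hs σ, Multiset.map_map]
    congr 3
    ext x
    exact (aeval_algHom_apply (σ.toAlgHom.restrictScalars ℤ) x g).symm
  obtain ⟨q, hq⟩ := hfix
  rw [← hq, isIntegral_algebraMap_iff (algebraMap ℚ K).injective,
    IsIntegrallyClosed.isIntegral_iff] at hint
  obtain ⟨M, rfl⟩ := hint
  exact ⟨M, by rw [← hq]; simp⟩

open Polynomial in
/-- Finitely many nonzero algebraic numbers are roots of an integer polynomial not vanishing
at `0`. -/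
theorem exists_eval_zero_ne_zero_and_aeval_eq_zero {K : Type*} [Field K]
    [Algebra.IsAlgebraic ℤ K] {s : Multiset K} (h₀ : (0 : K) ∉ s) :
    ∃ f : ℤ[X], f.eval 0 ≠ 0 ∧ ∀ x ∈ s, aeval x f = 0 := by
  induction s using Multiset.induction with
  | empty => exact ⟨1, by simp⟩
  | cons a s ih =>
    obtain ⟨ha, hs⟩ := not_or.mp (Multiset.mem_cons.not.mp h₀)
    obtain ⟨f, hf, hf'⟩ := ih hs
    obtain ⟨q, hq, hq'⟩ :=
      (Algebra.IsAlgebraic.isAlgebraic (R := ℤ) a).exists_nonzero_coeff_and_aeval_eq_zero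
        (mem_nonZeroDivisors_of_ne_zero (Ne.symm ha))
    refine ⟨q * f, ?_, fun x hx ↦ ?_⟩
    · rw [eval_mul]
      exact mul_ne_zero (by rwa [← coeff_zero_eq_eval_zero]) hf
    · obtain rfl | hx := Multiset.mem_cons.mp hx
      · rw [map_mul, hq', zero_mul]
      · rw [map_mul, hf' x hx, mul_zero]

open Polynomial Filter Topology in
/-- The sum of the exponentials of a Galois-stable multiset of nonzero algebraic numbers is not
a nonzero integer. -/
theorem intCast_add_sum_exp_ne_zero {K : Type*} [Field K] [Algebra ℚ K] [IsGalois ℚ K]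
    (φ : K →+* ℂ) {s : Multiset K} (hs : ∀ σ : Gal(K/ℚ), s.map σ = s) (h₀ : (0 : K) ∉ s)
    {k : ℤ} (hk : k ≠ 0) :
    (k : ℂ) + (s.map fun x ↦ Complex.exp (φ x)).sum ≠ 0 := by
  intro hsum
  have := IsLocalization.isAlgebraic ℚ (nonZeroDivisors ℤ)
  have : Algebra.IsAlgebraic ℤ K := Algebra.IsAlgebraic.trans ℤ ℚ K
  obtain ⟨f, hf, hroot⟩ := exists_eval_zero_ne_zero_and_aeval_eq_zero h₀
  classical
  obtain ⟨D, hD₀, hD⟩ := Algebra.IsAlgebraic.exists_integral_multiples ℤ s.toFinset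
  simp only [Multiset.mem_toFinset] at hD
  obtain ⟨c, hc⟩ := LindemannWeierstrass.exp_polynomial_approx f hf
  set d := f.natDegree
  set C : ℝ := |(D : ℝ)| ^ d * c with hC
  have key : ∀ p : ℕ, p.Prime → p > (f.eval 0).natAbs → p > k.natAbs → p > D.natAbs →
      1 ≤ s.card * (C ^ p / (p - 1).factorial) := by
    intro p hp hpf hpk hpD
    obtain ⟨n, hn, g, hg, happrox⟩ := hc p hpf hp
    obtain ⟨M, hM⟩ := exists_intCast_eq_pow_mul_sum_aeval hs hD (hg.trans (Nat.sub_le _ _))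
    have hM' : (M : ℂ) = (D : ℂ) ^ (p * d) * (s.map fun x ↦ aeval (φ x) g).sum := by
      have := congrArg φ hM
      rw [map_mul, map_pow, map_intCast, map_intCast, map_multiset_sum, Multiset.map_map] at this
      rw [this]
      congr 3
      ext x
      exact (aeval_algHom_apply φ.toIntAlgHom x g).symm
    have hnd : ∀ {a : ℤ}, a ≠ 0 → p > a.natAbs → ¬ (p : ℤ) ∣ a := fun ha hpa h ↦
      hpa.not_ge (Nat.le_of_dvd (Int.natAbs_pos.mpr ha) (Int.natCast_dvd.mp h))
    have hpZ : Prime (p : ℤ) := Nat.prime_iff_prime_int.mp hp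
    have hz : D ^ (p * d) * (n * k) + p * M ≠ 0 := by
      intro h
      have : (p : ℤ) ∣ D ^ (p * d) * (n * k) :=
        (dvd_add_left (dvd_mul_right _ M)).mp (h ▸ dvd_zero _)
      rcases hpZ.dvd_or_dvd this with h | h
      · exact hnd hD₀ hpD (hpZ.dvd_of_dvd_pow h)
      · exact (hpZ.dvd_or_dvd h).elim hn (hnd hk hpk)
    have hbound : ‖(s.map fun x ↦ n • Complex.exp (φ x) - p • aeval (φ x) g).sum‖ ≤
        s.card * (c ^ p / (p - 1).factorial) := by
      refine (norm_multiset_sum_le _).trans ?_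
      rw [Multiset.map_map, ← nsmul_eq_mul]
      refine (Multiset.sum_le_card_nsmul _ (c ^ p / (p - 1).factorial) fun y hy ↦ ?_).trans_eq
        (by rw [Multiset.card_map])
      obtain ⟨x, hx, rfl⟩ := Multiset.mem_map.mp hy
      refine happrox ((mem_aroots).mpr ⟨?_, ?_⟩)
      · rintro rfl
        simp at hf
      · have := aeval_algHom_apply φ.toIntAlgHom x f
        rw [hroot x hx, map_zero] at this
        exact this
    have hcast : ((D ^ (p * d) * (n * k) + p * M : ℤ) : ℂ) =
        -((D : ℂ) ^ (p * d) *
          (s.map fun x ↦ n • Complex.exp (φ x) - p • aeval (φ x) g).sum) := by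
      simp only [zsmul_eq_mul, nsmul_eq_mul]
      rw [Multiset.sum_map_sub, Multiset.sum_map_mul_left, Multiset.sum_map_mul_left]
      push_cast
      rw [hM']
      linear_combination (D : ℂ) ^ (p * d) * n * hsum
    calc (1 : ℝ) ≤ ‖((D ^ (p * d) * (n * k) + p * M : ℤ) : ℂ)‖ := by
          rw [Complex.norm_intCast]
          exact_mod_cast Int.one_le_abs hz
      _ ≤ |(D : ℝ)| ^ (p * d) * (s.card * (c ^ p / (p - 1).factorial)) := by
          rw [hcast, norm_neg, norm_mul, norm_pow, Complex.norm_intCast]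
          gcongr
      _ = s.card * (C ^ p / (p - 1).factorial) := by
          rw [hC, mul_pow, ← pow_mul, mul_comm d p]
          ring
  have hlim : Tendsto (fun p : ℕ ↦ s.card * (C ^ (p + 1) / p.factorial)) atTop (𝓝 0) := by
    have := (FloorSemiring.tendsto_pow_div_factorial_atTop C).const_mul (s.card * C)
    rw [mul_zero] at this
    refine this.congr fun p ↦ ?_
    ring
  obtain ⟨N, hN⟩ := eventually_atTop.mp (hlim.eventually (gt_mem_nhds one_pos))
  obtain ⟨p, hpN, hp⟩ := Nat.exists_infinite_primes
    (N + (f.eval 0).natAbs + k.natAbs + D.natAbs + 1)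
  have := hN (p - 1) (by lia)
  rw [Nat.sub_add_cancel hp.one_le] at this
  exact this.not_ge (key p hp (by lia) (by lia) (by lia))

theorem Multiset.powerset_map {α β : Type*} (f : α → β) (s : Multiset α) :
    (s.map f).powerset = s.powerset.map (Multiset.map f) := by
  induction s using Multiset.induction with
  | empty => simp
  | cons a s ih => simp [ih]

theorem Multiset.sum_map_powerset_exp_sum {K : Type*} [Semiring K] (φ : K →+* ℂ)
    (s : Multiset K) :
    ((s.powerset.map Multiset.sum).map fun x ↦ Complex.exp (φ x)).sum =
      (s.map fun x ↦ 1 + Complex.exp (φ x)).prod := by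
  induction s using Multiset.induction with
  | empty => simp
  | cons a s ih =>
    simp only [Multiset.map_map, Function.comp_def] at ih
    simp [Complex.exp_add, Multiset.sum_map_mul_left, ih, add_mul]

open Polynomial in
/-- If `K` is Galois over `ℚ`, then `exp` never takes the value `-1` on a complex embedding of `K`. -/
theorem exp_map_ne_neg_one {K : Type*} [Field K] [Algebra ℚ K] [IsGalois ℚ K]
    (φ : K →+* ℂ) (a : K) : Complex.exp (φ a) ≠ -1 := by
  intro ha
  classical
  set R := (minpoly ℚ a).aroots K
  have haR : a ∈ R := mem_aroots.mpr
    ⟨minpoly.ne_zero (Algebra.IsIntegral.isIntegral a), minpoly.aeval ℚ a⟩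
  have hR : ∀ σ : Gal(K/ℚ), R.map σ = R := fun σ ↦ by
    have := (IsGalois.splits ℚ a).roots_map (σ : K →+* K)
    rw [Polynomial.map_map] at this
    simp only [R, aroots]
    rw [show (σ : K →+* K).comp (algebraMap ℚ K) = algebraMap ℚ K from
      σ.toAlgHom.comp_algebraMap] at this
    exact this.symm
  set t := R.powerset.map Multiset.sum
  have ht : ∀ σ : Gal(K/ℚ), t.map σ = t := fun σ ↦ by
    conv_rhs => rw [show t = R.powerset.map Multiset.sum from rfl, ← hR σ, Multiset.powerset_map]
    simp only [t, Multiset.map_map, Function.comp_def, map_multiset_sum]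
  have hprod : (t.map fun x ↦ Complex.exp (φ x)).sum = 0 := by
    rw [Multiset.sum_map_powerset_exp_sum]
    exact Multiset.prod_eq_zero (Multiset.mem_map.mpr ⟨a, haR, by rw [ha]; ring⟩)
  rw [← Multiset.filter_add_not (· = 0) t, Multiset.map_add, Multiset.sum_add,
    Multiset.filter_eq' t 0, Multiset.map_replicate, Multiset.sum_replicate, map_zero,
    Complex.exp_zero, nsmul_one] at hprod
  have h₀ : (0 : K) ∈ t :=
    Multiset.mem_map.mpr ⟨0, Multiset.mem_powerset.mpr (Multiset.zero_le R), Multiset.sum_zero⟩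
  refine intCast_add_sum_exp_ne_zero φ (s := t.filter (¬ · = 0)) (fun σ ↦ ?_) (by simp)
    (k := t.count 0) (by exact_mod_cast (Multiset.count_pos.mpr h₀).ne') (by exact_mod_cast hprod)
  conv_rhs => rw [← ht σ, Multiset.filter_map]
  simp

open Polynomial in
/-- The exponential of an algebraic number is never `-1`. -/
theorem exp_ne_neg_one_of_isAlgebraic (K : Type*) [Field K] [Algebra ℚ K] [IsAlgClosure ℚ K]
    {z : ℂ} (hz : IsAlgebraic ℚ z) : Complex.exp z ≠ -1 := by
  have : IsAlgClosed K := IsAlgClosure.isAlgClosed ℚ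
  have : Algebra.IsAlgebraic ℚ K := IsAlgClosure.isAlgebraic
  let φ : K →ₐ[ℚ] ℂ := IsAlgClosed.lift
  have hroots := (IsAlgClosed.splits ((minpoly ℚ z).map (algebraMap ℚ K))).roots_map (φ : K →+* ℂ)
  rw [Polynomial.map_map, show (φ : K →+* ℂ).comp (algebraMap ℚ K) = algebraMap ℚ ℂ from
    φ.comp_algebraMap] at hroots
  have hmem : z ∈ (minpoly ℚ z).aroots ℂ :=
    mem_aroots.mpr ⟨minpoly.ne_zero hz.isIntegral, minpoly.aeval ℚ z⟩
  rw [aroots, hroots] at hmem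
  obtain ⟨a, -, rfl⟩ := Multiset.mem_map.mp hmem
  exact exp_map_ne_neg_one (φ : K →+* ℂ) a

/-- Lindemann's theorem: `π` is transcendental. -/
theorem transcendental_pi : Transcendental ℚ Real.pi := by
  intro h
  have hI : IsAlgebraic ℚ Complex.I := Complex.isIntegral_rat_I.isAlgebraic
  exact @exp_ne_neg_one_of_isAlgebraic _ _ _ (AlgebraicClosure.instIsAlgClosure ℚ) _
    ((h.algebraMap (A := ℂ)).mul hI) Complex.exp_pi_mul_I

/-- For every positive integer `n`, the value `ζ(2n) = Σ_{k≥1} 1/k^(2n)` of the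
Riemann zeta function at the even positive integer `2n` is irrational.
(The `k = 0` term of the `tsum` vanishes since `1/0 = 0` in Lean.) -/
theorem irrational_zeta_even (n : ℕ) (hn : 0 < n) :
    Irrational (∑' k : ℕ, 1 / (k : ℝ) ^ (2 * n)) := by
  set q : ℚ := (-1) ^ (n + 1) * 2 ^ (2 * n - 1) * bernoulli (2 * n) / (2 * n).factorial with hq
  have hval : ∑' k : ℕ, 1 / (k : ℝ) ^ (2 * n) = q * Real.pi ^ (2 * n) := by
    rw [(hasSum_zeta_nat hn.ne').tsum_eq, hq]
    push_cast
    ring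
  have hpos : (0 : ℝ) < q * Real.pi ^ (2 * n) := by
    rw [← hval]
    exact (hasSum_zeta_nat hn.ne').summable.tsum_pos (fun _ ↦ by positivity) 1 (by simp)
  rw [hval]
  rintro ⟨r, hr⟩
  have hq₀ : (q : ℝ) ≠ 0 := left_ne_zero_of_mul hpos.ne'
  have hpow : Real.pi ^ (2 * n) = algebraMap ℚ ℝ (r / q) := by
    rw [eq_ratCast, Rat.cast_div, hr]
    field_simp
  refine transcendental_pi (IsAlgebraic.of_pow (n := 2 * n) (by lia) ?_)
  rw [hpow]
  exact isAlgebraic_algebraMap _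
end

section
/- (Thue–Siegel–Roth) Let ξ be a real algebraic irrational number and let ε > 0. Then there are only finitely many rational numbers p/q (with integers p and q ≥ 1) satisfying |ξ − p/q| ≤ 1/q^{2+ε}. -/
namespace Roth

open MvPolynomial

section Length

variable {σ R : Type*} [NormedCommRing R]

/-- The sum of the norms of the coefficients. -/
noncomputable def length (P : MvPolynomial σ R) : ℝ := ∑ α ∈ P.support, ‖coeff α P‖

lemma length_nonneg (P : MvPolynomial σ R) : 0 ≤ length P :=
  Finset.sum_nonneg fun _ _ => norm_nonneg _

lemma length_eq_sum {P : MvPolynomial σ R} {s : Finset (σ →₀ ℕ)} (h : P.support ⊆ s) :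
    length P = ∑ α ∈ s, ‖coeff α P‖ :=
  Finset.sum_subset h fun α _ hα => by rw [notMem_support_iff.1 hα, norm_zero]

lemma sum_norm_coeff_le_length (P : MvPolynomial σ R) (s : Finset (σ →₀ ℕ)) :
    ∑ α ∈ s, ‖coeff α P‖ ≤ length P := by
  classical
  rw [length_eq_sum (Finset.subset_union_right (s₁ := s))]
  exact Finset.sum_le_sum_of_subset_of_nonneg Finset.subset_union_left fun _ _ _ => norm_nonneg _

lemma norm_coeff_le_length (P : MvPolynomial σ R) (α : σ →₀ ℕ) : ‖coeff α P‖ ≤ length P := by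
  simpa using sum_norm_coeff_le_length P {α}

lemma length_zero : length (0 : MvPolynomial σ R) = 0 := by simp [length]

lemma length_add_le (P Q : MvPolynomial σ R) : length (P + Q) ≤ length P + length Q := by
  classical
  rw [length_eq_sum (support_add (p := P) (q := Q)),
    length_eq_sum (Finset.subset_union_left (s₁ := P.support) (s₂ := Q.support)),
    length_eq_sum (Finset.subset_union_right (s₁ := P.support) (s₂ := Q.support)),
    ← Finset.sum_add_distrib]
  exact Finset.sum_le_sum fun α _ => by rw [coeff_add]; exact norm_add_le _ _

lemma length_sum_le {ι : Type*} (s : Finset ι) (P : ι → MvPolynomial σ R) :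
    length (∑ i ∈ s, P i) ≤ ∑ i ∈ s, length (P i) := by
  classical
  induction s using Finset.induction_on with
  | empty => simp [length_zero]
  | insert a s ha ih =>
    rw [Finset.sum_insert ha, Finset.sum_insert ha]
    exact (length_add_le _ _).trans (by gcongr)

lemma length_monomial (α : σ →₀ ℕ) (a : R) : length (monomial α a) = ‖a‖ := by
  classical
  rw [length_eq_sum support_monomial_subset]
  simp

lemma length_mul_le (P Q : MvPolynomial σ R) : length (P * Q) ≤ length P * length Q := by
  rw [mul_def, Finsupp.sum]
  refine (length_sum_le _ _).trans ?_
  rw [length, Finset.sum_mul]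
  refine Finset.sum_le_sum fun α _ => (length_sum_le _ _).trans ?_
  rw [length, Finset.mul_sum]
  refine Finset.sum_le_sum fun β _ => ?_
  rw [length_monomial]
  exact norm_mul_le _ _

lemma length_prod_le [NormOneClass R] {ι : Type*} (s : Finset ι) (P : ι → MvPolynomial σ R) :
    length (∏ i ∈ s, P i) ≤ ∏ i ∈ s, length (P i) := by
  classical
  induction s using Finset.induction_on with
  | empty =>
    rw [Finset.prod_empty, Finset.prod_empty, ← C_1, ← monomial_zero', length_monomial, norm_one]
  | insert a s ha ih =>
    rw [Finset.prod_insert ha, Finset.prod_insert ha]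
    exact (length_mul_le _ _).trans (by gcongr; exact length_nonneg _)

lemma length_neg (P : MvPolynomial σ R) : length (-P) = length P := by
  simp [length]

lemma length_det_le [NormOneClass R] {k : ℕ} {M : Matrix (Fin k) (Fin k) (MvPolynomial σ R)} {B : ℝ}
    (h : ∀ i j, length (M i j) ≤ B) : length M.det ≤ k.factorial * B ^ k := by
  rw [Matrix.det_apply]
  refine (length_sum_le _ _).trans ?_
  have h1 : ∀ s : Equiv.Perm (Fin k), length (Equiv.Perm.sign s • ∏ i, M (s i) i) ≤ B ^ k := by
    intro s
    have h2 : length (Equiv.Perm.sign s • ∏ i, M (s i) i) = length (∏ i, M (s i) i) := by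
      rcases Int.units_eq_one_or (Equiv.Perm.sign s) with h | h <;> simp [h, length_neg]
    rw [h2]
    refine (length_prod_le _ _).trans ?_
    refine (Finset.prod_le_prod (fun _ _ => length_nonneg _) fun i _ => h (s i) i).trans ?_
    simp
  refine (Finset.sum_le_sum fun s _ => h1 s).trans ?_
  simp [Fintype.card_perm]

end Length

section Translate

variable {σ R : Type*} [Fintype σ]

/-- Product of the coordinatewise binomial coefficients. -/
def multichoose (α μ : σ →₀ ℕ) : ℕ := ∏ i, (α i).choose (μ i)

lemma multichoose_eq_zero {α μ : σ →₀ ℕ} (h : ¬ μ ≤ α) : multichoose α μ = 0 := by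
  rw [Finsupp.le_def] at h
  push Not at h
  obtain ⟨i, hi⟩ := h
  exact Finset.prod_eq_zero (Finset.mem_univ i) (Nat.choose_eq_zero_of_lt hi)

lemma multichoose_le (α μ : σ →₀ ℕ) : multichoose α μ ≤ 2 ^ ∑ i, α i := by
  rw [← Finset.prod_pow_eq_pow_sum]
  exact Finset.prod_le_prod' fun i _ => Nat.choose_le_two_pow _ _

lemma multichoose_zero (α : σ →₀ ℕ) : multichoose α 0 = 1 := by simp [multichoose]

lemma multichoose_mul (β γ μ : σ →₀ ℕ) :
    multichoose (γ + β) β * multichoose (γ + β + μ) μ =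
      multichoose (β + μ) μ * multichoose (γ + (β + μ)) (β + μ) := by
  simp only [multichoose, ← Finset.prod_mul_distrib]
  refine Finset.prod_congr rfl fun i _ => ?_
  have := Nat.choose_mul (n := γ i + (β i + μ i)) (k := β i + μ i) (s := μ i) (by omega)
  simp only [Finsupp.add_apply]
  rw [show γ i + (β i + μ i) - μ i = γ i + β i by omega,
    show β i + μ i - μ i = β i by omega] at this
  rw [add_assoc]
  linarith

section CommRing

variable [CommRing R]

/-- The Hasse derivative of a multivariate polynomial. -/
noncomputable def hasse (μ : σ →₀ ℕ) : MvPolynomial σ R →ₗ[R] MvPolynomial σ R :=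
  (basisMonomials σ R).constr R fun α => monomial (α - μ) (multichoose α μ : R)

lemma hasse_monomial (μ α : σ →₀ ℕ) (a : R) :
    hasse μ (monomial α a) = monomial (α - μ) (multichoose α μ * a) := by
  have h : monomial α a = a • basisMonomials σ R α := by
    simp [coe_basisMonomials, smul_monomial]
  rw [h, map_smul, hasse, Module.Basis.constr_basis, smul_monomial, smul_eq_mul, mul_comm]

lemma coeff_hasse (μ β : σ →₀ ℕ) (P : MvPolynomial σ R) :
    coeff β (hasse μ P) = multichoose (β + μ) μ * coeff (β + μ) P := by
  classical
  induction P using MvPolynomial.induction_on' with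
  | monomial α a =>
    rw [hasse_monomial, coeff_monomial, coeff_monomial]
    by_cases h : α = β + μ
    · simp [h]
    · rw [if_neg h, mul_zero]
      split_ifs with h1
      · rw [multichoose_eq_zero, Nat.cast_zero, zero_mul]
        intro h2
        exact h (by rw [← h1, tsub_add_cancel_of_le h2])
      · rfl
  | add p q hp hq => rw [map_add, coeff_add, hp, hq, coeff_add, mul_add]

lemma hasse_hasse (β μ : σ →₀ ℕ) (P : MvPolynomial σ R) :
    hasse β (hasse μ P) = (multichoose (β + μ) μ : R) • hasse (β + μ) P := by
  ext γ
  rw [coeff_hasse, coeff_hasse, coeff_smul, coeff_hasse, smul_eq_mul, ← mul_assoc, ← mul_assoc,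
    add_assoc]
  have := multichoose_mul β γ μ
  rw [← add_assoc]
  rw [← add_assoc] at this
  exact_mod_cast congrArg (fun t : ℕ => (t : R) * coeff (γ + β + μ) P) this

lemma hasse_map {S : Type*} [CommRing S] (f : R →+* S) (μ : σ →₀ ℕ) (P : MvPolynomial σ R) :
    hasse μ (map f P) = map f (hasse μ P) := by
  ext γ
  simp [coeff_hasse, coeff_map]

lemma degreeOf_hasse_le (μ : σ →₀ ℕ) (P : MvPolynomial σ R) (i : σ) :
    degreeOf i (hasse μ P) ≤ degreeOf i P := by
  rw [degreeOf_le_iff]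
  intro m hm
  rw [mem_support_iff, coeff_hasse] at hm
  have h : m + μ ∈ P.support := mem_support_iff.2 (right_ne_zero_of_mul hm)
  have := monomial_le_degreeOf i h
  rw [Finsupp.add_apply] at this
  omega

lemma multichoose_pascal [DecidableEq σ] (γ β : σ →₀ ℕ) (i : σ) :
    multichoose (γ + Finsupp.single i 1 + (β + Finsupp.single i 1)) (β + Finsupp.single i 1) =
      multichoose (γ + (β + Finsupp.single i 1)) (β + Finsupp.single i 1) +
      multichoose (γ + Finsupp.single i 1 + β) β := by
  have h : ∀ α μ α' μ' : σ →₀ ℕ, (∀ j, j ≠ i → α j = α' j ∧ μ j = μ' j) →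
      ∏ j ∈ Finset.univ.erase i, (α j).choose (μ j) =
        ∏ j ∈ Finset.univ.erase i, (α' j).choose (μ' j) := fun α μ α' μ' h =>
    Finset.prod_congr rfl fun j hj => by
      rw [(h j (Finset.ne_of_mem_erase hj)).1, (h j (Finset.ne_of_mem_erase hj)).2]
  simp only [multichoose, ← Finset.mul_prod_erase _ _ (Finset.mem_univ i)]
  rw [h _ _ (γ + β) β, h (γ + (β + _)) _ (γ + β) β, h (γ + _ + β) _ (γ + β) β, ← add_mul]
  · congr 1
    simp only [Finsupp.add_apply, Finsupp.single_eq_same]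
    rw [show γ i + 1 + (β i + 1) = (γ i + β i + 1) + 1 by ring, Nat.choose_succ_succ, add_comm,
      show γ i + (β i + 1) = γ i + β i + 1 by ring, show γ i + 1 + β i = γ i + β i + 1 by ring]
  all_goals
    intro j hj
    simp [Finsupp.single_eq_of_ne hj]

lemma hasse_mul_X [DecidableEq σ] (β : σ →₀ ℕ) (P : MvPolynomial σ R) (i : σ) :
    hasse (β + Finsupp.single i 1) (P * X i) =
      hasse (β + Finsupp.single i 1) P * X i + hasse β P := by
  ext γ
  rw [coeff_hasse, coeff_add, coeff_hasse, ← add_assoc, coeff_mul_X, coeff_mul_X']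
  split_ifs with h
  · obtain ⟨γ', rfl⟩ : ∃ γ', γ = γ' + Finsupp.single i 1 := by
      refine ⟨γ - Finsupp.single i 1, (tsub_add_cancel_of_le ?_).symm⟩
      rw [Finsupp.single_le_iff]
      have := Finsupp.mem_support_iff.1 h
      omega
    rw [add_tsub_cancel_right, coeff_hasse, add_assoc (γ' + _), multichoose_pascal,
      show γ' + Finsupp.single i 1 + β = γ' + (β + Finsupp.single i 1) by abel]
    push_cast
    ring
  · rw [Finsupp.mem_support_iff, not_not] at h
    rw [zero_add]
    congr 2
    refine Finset.prod_congr rfl fun j _ => ?_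
    simp only [Finsupp.add_apply]
    by_cases hj : j = i
    · subst hj; simp [h]
    · simp [Finsupp.single_eq_of_ne hj]

lemma hasse_mul_X_of_eq_zero (β : σ →₀ ℕ) (P : MvPolynomial σ R) (i : σ) (hi : β i = 0) :
    hasse β (P * X i) = hasse β P * X i := by
  classical
  ext γ
  rw [coeff_hasse, coeff_mul_X', coeff_mul_X']
  have h2 : i ∈ (γ + β).support ↔ i ∈ γ.support := by simp [hi]
  simp only [h2]
  split_ifs with h
  · obtain ⟨γ', rfl⟩ : ∃ γ', γ = γ' + Finsupp.single i 1 := by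
      refine ⟨γ - Finsupp.single i 1, (tsub_add_cancel_of_le ?_).symm⟩
      rw [Finsupp.single_le_iff]
      have := Finsupp.mem_support_iff.1 h
      omega
    rw [add_tsub_cancel_right, coeff_hasse,
      show γ' + Finsupp.single i 1 + β = γ' + β + Finsupp.single i 1 by abel, add_tsub_cancel_right]
    congr 2
    refine Finset.prod_congr rfl fun j _ => ?_
    simp only [Finsupp.add_apply]
    by_cases hj : i = j
    · subst hj; simp [hi]
    · simp [Finsupp.single_eq_of_ne' hj]
  · simp

/-- The substitution `x ↦ x + c`. -/
noncomputable def translate (c : σ → R) : MvPolynomial σ R →ₐ[R] MvPolynomial σ R :=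
  aeval fun i => X i + C (c i)

/-- Taylor's formula. -/
lemma coeff_translate (c : σ → R) (β : σ →₀ ℕ) (P : MvPolynomial σ R) :
    coeff β (translate c P) = eval c (hasse β P) := by
  classical
  induction P using MvPolynomial.induction_on generalizing β with
  | C a =>
    rw [translate, aeval_C, algebraMap_eq, ← monomial_zero', hasse_monomial, coeff_monomial,
      eval_monomial]
    split_ifs with h
    · simp [← h, multichoose_zero]
    · rw [multichoose_eq_zero]
      · simp
      · intro h1
        exact h (le_antisymm bot_le h1)
  | add p q hp hq => rw [map_add, coeff_add, hp, hq, map_add, map_add]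
  | mul_X p i hp =>
    rw [map_mul]
    conv_lhs => rw [translate, aeval_X, ← translate]
    rw [mul_add, coeff_add, mul_comm _ (C _), coeff_C_mul, coeff_mul_X', hp]
    split_ifs with h
    · obtain ⟨γ', rfl⟩ : ∃ γ', β = γ' + Finsupp.single i 1 := by
        refine ⟨β - Finsupp.single i 1, (tsub_add_cancel_of_le ?_).symm⟩
        rw [Finsupp.single_le_iff]
        have := Finsupp.mem_support_iff.1 h
        omega
      rw [add_tsub_cancel_right, hasse_mul_X, hp, map_add, map_mul, eval_X, add_comm, mul_comm (c i)]
    · rw [Finsupp.mem_support_iff, not_not] at h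
      rw [hasse_mul_X_of_eq_zero _ _ _ h, map_mul, eval_X, zero_add, mul_comm, hp]

lemma coeff_translate_hasse (c : σ → R) (β μ : σ →₀ ℕ) (P : MvPolynomial σ R) :
    coeff β (translate c (hasse μ P)) =
      multichoose (β + μ) μ * coeff (β + μ) (translate c P) := by
  rw [coeff_translate, hasse_hasse, smul_eval, coeff_translate]

lemma eval_translate {σ : Type*} (c d : σ → R) (P : MvPolynomial σ R) :
    eval d (translate c P) = eval (fun i => d i + c i) P := by
  induction P using MvPolynomial.induction_on with
  | C a => simp [translate]
  | add p q hp hq => simp [hp, hq]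
  | mul_X p i hp => rw [map_mul, map_mul, hp, map_mul, translate, aeval_X]; simp

/-- `P` vanishes at `c` to order at least `θ`, where the variable `i` has weight `1 / r i`. -/
def VanishesTo (c : σ → R) (r : σ → ℕ) (θ : ℝ) (P : MvPolynomial σ R) : Prop :=
  ∀ β : σ →₀ ℕ, ∑ i, (β i : ℝ) / r i < θ → coeff β (translate c P) = 0

lemma VanishesTo.mono {c : σ → R} {r : σ → ℕ} {θ θ' : ℝ} {P : MvPolynomial σ R}
    (h : VanishesTo c r θ P) (hθ : θ' ≤ θ) : VanishesTo c r θ' P :=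
  fun β hβ => h β (hβ.trans_le hθ)

lemma vanishesTo_of_nonpos {c : σ → R} {r : σ → ℕ} {θ : ℝ} {P : MvPolynomial σ R}
    (hθ : θ ≤ 0) : VanishesTo c r θ P := fun β hβ =>
  absurd (hβ.trans_le hθ) (not_lt.2 (Finset.sum_nonneg fun _ _ => by positivity))

lemma VanishesTo.sum {ι : Type*} {c : σ → R} {r : σ → ℕ} {θ : ℝ} {s : Finset ι}
    {P : ι → MvPolynomial σ R} (h : ∀ j ∈ s, VanishesTo c r θ (P j)) :
    VanishesTo c r θ (∑ j ∈ s, P j) := fun β hβ => by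
  rw [map_sum, coeff_sum]
  exact Finset.sum_eq_zero fun j hj => h j hj β hβ

lemma VanishesTo.mul {c : σ → R} {r : σ → ℕ} {θ θ' : ℝ} {P Q : MvPolynomial σ R}
    (hP : VanishesTo c r θ P) (hQ : VanishesTo c r θ' Q) :
    VanishesTo c r (θ + θ') (P * Q) := fun β hβ => by
  classical
  rw [map_mul, coeff_mul]
  refine Finset.sum_eq_zero fun x hx => ?_
  rw [Finset.HasAntidiagonal.mem_antidiagonal] at hx
  by_cases h1 : ∑ i, (x.1 i : ℝ) / r i < θ
  · rw [hP _ h1, zero_mul]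
  · rw [hQ _, mul_zero]
    have : ∑ i, (β i : ℝ) / r i = ∑ i, (x.1 i : ℝ) / r i + ∑ i, (x.2 i : ℝ) / r i := by
      rw [← Finset.sum_add_distrib]
      refine Finset.sum_congr rfl fun i _ => ?_
      rw [← hx, Finsupp.add_apply, Nat.cast_add, add_div]
    linarith

lemma VanishesTo.prod {ι : Type*} {c : σ → R} {r : σ → ℕ} {s : Finset ι} {θ : ι → ℝ}
    {P : ι → MvPolynomial σ R} (h : ∀ j ∈ s, VanishesTo c r (θ j) (P j)) :
    VanishesTo c r (∑ j ∈ s, θ j) (∏ j ∈ s, P j) := by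
  classical
  induction s using Finset.induction_on with
  | empty => exact vanishesTo_of_nonpos (by simp)
  | insert a s ha ih =>
    rw [Finset.sum_insert ha, Finset.prod_insert ha]
    exact (h a (Finset.mem_insert_self a s)).mul
      (ih fun j hj => h j (Finset.mem_insert_of_mem hj))

lemma VanishesTo.hasse {c : σ → R} {r : σ → ℕ} {θ : ℝ} {P : MvPolynomial σ R}
    (h : VanishesTo c r θ P) (μ : σ →₀ ℕ) :
    VanishesTo c r (θ - ∑ i, (μ i : ℝ) / r i) (hasse μ P) := fun β hβ => by
  rw [coeff_translate_hasse, h, mul_zero]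
  simp only [Finsupp.add_apply, Nat.cast_add, add_div, Finset.sum_add_distrib]
  linarith

/-- A determinant vanishes at least to the sum of the orders assigned to its columns. -/
lemma VanishesTo.det {ι : Type*} [Fintype ι] [DecidableEq ι] {c : σ → R} {r : σ → ℕ} {θ : ι → ℝ}
    {M : Matrix ι ι (MvPolynomial σ R)} (h : ∀ i j, VanishesTo c r (θ j) (M i j)) :
    VanishesTo c r (∑ j, θ j) M.det := by
  rw [Matrix.det_apply]
  refine VanishesTo.sum fun s _ => ?_
  have := VanishesTo.prod (s := Finset.univ) fun j _ => h (s j) j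
  intro β hβ
  rw [Units.smul_def, map_zsmul, coeff_smul, this β hβ, smul_zero]

end CommRing

lemma length_hasse_le (μ : σ →₀ ℕ) (r : σ → ℕ) (P : MvPolynomial σ ℤ)
    (hP : ∀ i, degreeOf i P ≤ r i) : length (hasse μ P) ≤ 2 ^ (∑ i, r i) * length P := by
  classical
  have h : hasse μ P = ∑ α ∈ P.support, monomial (α - μ) (multichoose α μ * coeff α P) := by
    conv_lhs => rw [P.as_sum]
    rw [map_sum]
    exact Finset.sum_congr rfl fun α _ => hasse_monomial _ _ _
  rw [h]
  refine (length_sum_le _ _).trans ?_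
  rw [length, Finset.mul_sum]
  refine Finset.sum_le_sum fun α hα => ?_
  rw [length_monomial, norm_mul]
  gcongr
  rw [Int.norm_natCast]
  calc (multichoose α μ : ℝ) ≤ 2 ^ ∑ i, α i := by exact_mod_cast multichoose_le α μ
    _ ≤ 2 ^ ∑ i, r i := by
      gcongr with i
      · norm_num
      · exact (monomial_le_degreeOf i hα).trans (hP i)

end Translate

section Wronskian

variable {σ : Type*} [Fintype σ]

lemma multichoose_add_single [DecidableEq σ] (α μ : σ →₀ ℕ) (i : σ) :
    α i * multichoose α μ =
      (μ i + 1) * multichoose α (μ + Finsupp.single i 1) + μ i * multichoose α μ := by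
  simp only [multichoose, ← Finset.mul_prod_erase _ _ (Finset.mem_univ i)]
  have h : ∏ j ∈ Finset.univ.erase i, (α j).choose ((μ + Finsupp.single i 1 : σ →₀ ℕ) j) =
      ∏ j ∈ Finset.univ.erase i, (α j).choose (μ j) :=
    Finset.prod_congr rfl fun j hj => by simp [Finsupp.single_eq_of_ne (Finset.ne_of_mem_erase hj)]
  rw [h]
  simp only [Finsupp.add_apply, Finsupp.single_eq_same]
  have h2 := Nat.choose_succ_right_eq (α i) (μ i)
  have h3 : α i * (α i).choose (μ i) =
      (μ i + 1) * (α i).choose (μ i + 1) + μ i * (α i).choose (μ i) := by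
    rw [mul_comm (μ i + 1), h2]
    rcases le_or_gt (μ i) (α i) with h | h
    · obtain ⟨t, ht⟩ := Nat.exists_eq_add_of_le h
      rw [ht, Nat.add_sub_cancel_left]
      ring
    · simp [Nat.choose_eq_zero_of_lt h]
  rw [← mul_assoc, h3]
  ring

/-- The functions `j ↦ multichoose (α j) μ` with `|μ| ≤ d`. -/
def multichooseSet {ι : Type*} (α : ι → σ →₀ ℕ) (d : ℕ) : Set (ι → ℚ) :=
  {v | ∃ μ : σ →₀ ℕ, ∑ i, μ i ≤ d ∧ v = fun j => (multichoose (α j) μ : ℚ)}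

lemma mul_mem_span_multichooseSet {ι : Type*} (α : ι → σ →₀ ℕ) (d : ℕ) (i : σ) (a : ℚ)
    {v : ι → ℚ} (hv : v ∈ Submodule.span ℚ (multichooseSet α d)) :
    (fun j => ((α j i : ℚ) - a) * v j) ∈ Submodule.span ℚ (multichooseSet α (d + 1)) := by
  classical
  induction hv using Submodule.span_induction with
  | mem v hv =>
    obtain ⟨μ, hμ, rfl⟩ := hv
    have h1 : (fun j => (multichoose (α j) (μ + Finsupp.single i 1) : ℚ)) ∈
        Submodule.span ℚ (multichooseSet α (d + 1)) := by
      refine Submodule.subset_span ⟨_, ?_, rfl⟩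
      simp only [Finsupp.add_apply, Finset.sum_add_distrib]
      have : ∑ j, (Finsupp.single i 1 : σ →₀ ℕ) j = 1 := by simp [Finsupp.single_apply]
      omega
    have h2 : (fun j => (multichoose (α j) μ : ℚ)) ∈
        Submodule.span ℚ (multichooseSet α (d + 1)) :=
      Submodule.subset_span ⟨μ, by omega, rfl⟩
    convert Submodule.add_mem _ (Submodule.smul_mem _ ((μ i : ℚ) + 1) h1)
      (Submodule.smul_mem _ ((μ i : ℚ) - a) h2) using 1
    ext j
    have := multichoose_add_single (α j) μ i
    have h3 : (α j i : ℚ) * multichoose (α j) μ =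
      (μ i + 1) * multichoose (α j) (μ + Finsupp.single i 1) + μ i * multichoose (α j) μ := by
      exact_mod_cast this
    simp only [Pi.add_apply, Pi.smul_apply, smul_eq_mul]
    linarith
  | zero =>
    convert Submodule.zero_mem (Submodule.span ℚ (multichooseSet α (d + 1))) using 1
    ext j
    simp
  | add v w _ _ hv hw =>
    convert Submodule.add_mem _ hv hw using 1
    ext j
    simp [mul_add]
  | smul t v _ hv =>
    convert Submodule.smul_mem _ t hv using 1
    ext j
    simp only [Pi.smul_apply, smul_eq_mul]
    ring

lemma exists_mem_span_multichooseSet {ι : Type*} [DecidableEq ι] {α : ι → σ →₀ ℕ}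
    (hα : Function.Injective α) (j₀ : ι) (s : Finset ι) (hs : j₀ ∉ s) :
    ∃ v ∈ Submodule.span ℚ (multichooseSet α s.card), v j₀ ≠ 0 ∧ ∀ j ∈ s, v j = 0 := by
  induction s using Finset.induction_on with
  | empty =>
    refine ⟨fun _ => 1, Submodule.subset_span ⟨0, by simp, ?_⟩, by simp, by simp⟩
    ext j
    simp [multichoose_zero]
  | insert a s ha ih =>
    obtain ⟨v, hv, hv0, hvs⟩ := ih fun h => hs (Finset.mem_insert_of_mem h)
    have hne : α j₀ ≠ α a := fun h => hs (by rw [hα h]; exact Finset.mem_insert_self _ _)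
    obtain ⟨i, hi⟩ := Finsupp.ne_iff.1 hne
    rw [Finset.card_insert_of_notMem ha]
    refine ⟨_, mul_mem_span_multichooseSet α _ i (α a i) hv, ?_, ?_⟩
    · refine mul_ne_zero ?_ hv0
      rw [sub_ne_zero]
      exact_mod_cast hi
    · intro j hj
      rcases Finset.mem_insert.1 hj with rfl | hj
      · simp
      · simp [hvs j hj]

lemma exists_det_multichoose_ne_zero {k : ℕ} {α : Fin k → σ →₀ ℕ} (hα : Function.Injective α) :
    ∃ μ : Fin k → σ →₀ ℕ, (∀ i, ∑ l, μ i l < k) ∧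
      (Matrix.of fun i j => (multichoose (α j) (μ i) : ℚ)).det ≠ 0 := by
  have htop : Submodule.span ℚ (multichooseSet α (k - 1)) = ⊤ := by
    rw [eq_top_iff, ← (Pi.basisFun ℚ (Fin k)).span_eq, Submodule.span_le]
    rintro _ ⟨j, rfl⟩
    obtain ⟨v, hv, hv0, hvs⟩ := exists_mem_span_multichooseSet hα j (Finset.univ.erase j)
      (Finset.notMem_erase _ _)
    rw [Finset.card_erase_of_mem (Finset.mem_univ j), Finset.card_univ, Fintype.card_fin] at hv
    have : (Pi.basisFun ℚ (Fin k)) j = (v j)⁻¹ • v := by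
      ext l
      rw [Pi.basisFun_apply, Pi.smul_apply, smul_eq_mul]
      by_cases h : l = j
      · subst h; simp [hv0]
      · rw [hvs l (Finset.mem_erase.2 ⟨h, Finset.mem_univ _⟩)]
        simp [h]
    rw [this]
    exact Submodule.smul_mem _ _ hv
  obtain ⟨b, hb, hspan, hli⟩ := exists_linearIndependent ℚ (multichooseSet α (k - 1))
  rw [htop] at hspan
  let B : Module.Basis b ℚ (Fin k → ℚ) := Module.Basis.mk hli (by rw [Subtype.range_coe, hspan])
  have : Fintype b := FiniteDimensional.fintypeBasisIndex B
  have hcard : Fintype.card b = k := by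
    rw [← Module.finrank_eq_card_basis B, Module.finrank_fin_fun]
  let e : Fin k ≃ b := (Fintype.equivFinOfCardEq hcard).symm
  choose μ hμ hμ' using fun i => hb (e i).2
  refine ⟨μ, fun i => ?_, ?_⟩
  · have := hμ i
    have := i.2
    omega
  · have h : LinearIndependent ℚ (Matrix.of fun i j => (multichoose (α j) (μ i) : ℚ)).row := by
      have h1 : (Matrix.of fun i j => (multichoose (α j) (μ i) : ℚ)).row = Subtype.val ∘ e := by
        ext i j
        simp [hμ' i, Matrix.row]
      rw [h1]
      exact hli.comp e e.injective
    rw [Matrix.linearIndependent_rows_iff_isUnit, Matrix.isUnit_iff_isUnit_det] at h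
    exact h.ne_zero

lemma exists_injective_degree {σ : Type*} (m : MonomialOrder σ) {k : ℕ} {f : Fin k → MvPolynomial σ ℚ}
    (hf : LinearIndependent ℚ f) :
    ∃ A : Matrix (Fin k) (Fin k) ℚ, (∀ j, ∑ l, A j l • f l ≠ 0) ∧
      Function.Injective fun j => m.degree (∑ l, A j l • f l) := by
  classical
  let V := Submodule.span ℚ (Set.range f)
  have hV : Module.finrank ℚ V = k := by
    rw [finrank_span_eq_card hf, Fintype.card_fin]
  let D : Set (σ →₀ ℕ) := {d | ∃ v ∈ V, v ≠ 0 ∧ m.degree v = d}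
  have hD : ∃ t : Finset (σ →₀ ℕ), (t : Set (σ →₀ ℕ)) ⊆ D ∧ t.card = k := by
    by_cases hfin : D.Finite
    · lift D to Finset (σ →₀ ℕ) using hfin with D' hD'
      have hle : k ≤ D'.card := by
        let φ : V →ₗ[ℚ] (D' → ℚ) :=
          { toFun := fun v d => coeff d.1 v.1
            map_add' := fun v w => by ext d; simp
            map_smul' := fun t v => by ext d; simp }
        have hφ : Function.Injective φ := by
          rw [injective_iff_map_eq_zero]
          intro v hv
          by_contra hne
          have hne' : v.1 ≠ 0 := fun h => hne (Subtype.ext h)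
          have hmem : m.degree v.1 ∈ D' := by
            rw [← Finset.mem_coe, hD']
            exact ⟨v.1, v.2, hne', rfl⟩
          exact m.coeff_degree_ne_zero_iff.2 hne' (congrFun hv ⟨_, hmem⟩)
        have := LinearMap.finrank_le_finrank_of_injective hφ
        rwa [hV, Module.finrank_fintype_fun_eq_card, Fintype.card_coe] at this
      obtain ⟨t, ht, htc⟩ := Finset.exists_subset_card_eq hle
      exact ⟨t, by exact_mod_cast ht, htc⟩
    · exact Set.Infinite.exists_subset_card_eq hfin k
  obtain ⟨t, htD, htc⟩ := hD
  let e : Fin k ≃ t := (Fintype.equivFinOfCardEq (by rw [Fintype.card_coe, htc])).symm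
  choose v hvV hv0 hvd using fun j => htD (e j).2
  choose A hA using fun j => (Submodule.mem_span_range_iff_exists_fun ℚ).1 (hvV j)
  refine ⟨A, fun j => ?_, fun i j hij => ?_⟩
  · rw [hA]; exact hv0 j
  · simp only [hA, hvd] at hij
    exact e.injective (Subtype.ext hij)

lemma degree_prod_le_and_coeff {σ : Type*} (m : MonomialOrder σ) {R ι : Type*} [CommRing R] (s : Finset ι)
    {P : ι → MvPolynomial σ R} {τ : ι → σ →₀ ℕ}
    (h : ∀ j ∈ s, m.toSyn (m.degree (P j)) ≤ m.toSyn (τ j)) :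
    m.toSyn (m.degree (∏ j ∈ s, P j)) ≤ m.toSyn (∑ j ∈ s, τ j) ∧
      coeff (∑ j ∈ s, τ j) (∏ j ∈ s, P j) = ∏ j ∈ s, coeff (τ j) (P j) := by
  classical
  induction s using Finset.induction_on with
  | empty => simp
  | insert a s ha ih =>
    obtain ⟨h1, h2⟩ := ih fun j hj => h j (Finset.mem_insert_of_mem hj)
    have h3 := h a (Finset.mem_insert_self a s)
    rw [Finset.sum_insert ha, Finset.prod_insert ha, Finset.prod_insert ha, ← h2]
    refine ⟨?_, m.coeff_mul_of_add_of_degree_le h3 h1⟩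
    refine m.degree_mul_le.trans ?_
    rw [map_add, map_add]
    exact add_le_add h3 h1

/-- Generalized Wronskians detect linear independence. -/
theorem exists_wronskian_ne_zero [LinearOrder σ] {k : ℕ} {f : Fin k → MvPolynomial σ ℚ}
    (hf : LinearIndependent ℚ f) :
    ∃ μ : Fin k → σ →₀ ℕ, (∀ i, ∑ l, μ i l < k) ∧
      (Matrix.of fun i j => hasse (μ i) (f j)).det ≠ 0 := by
  let m : MonomialOrder σ := MonomialOrder.lex
  obtain ⟨A, hA0, hAinj⟩ := exists_injective_degree m hf
  set g : Fin k → MvPolynomial σ ℚ := fun j => ∑ l, A j l • f l with hg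
  obtain ⟨μ, hμ, hdet⟩ := exists_det_multichoose_ne_zero hAinj
  refine ⟨μ, hμ, fun h0 => ?_⟩
  have h1 : (Matrix.of fun i j => hasse (μ i) (g j)).det = 0 := by
    have : (Matrix.of fun i j => hasse (μ i) (g j)) =
        (Matrix.of fun i j => hasse (μ i) (f j)) * (A.map C).transpose := by
      ext1 i j
      rw [Matrix.mul_apply]
      simp only [hg, Matrix.of_apply, Matrix.transpose_apply, Matrix.map_apply, map_sum, map_smul]
      exact Finset.sum_congr rfl fun l _ => by rw [mul_comm, C_mul']
    rw [this, Matrix.det_mul, h0, zero_mul]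
  let M : Matrix (Fin k) (Fin k) (MvPolynomial σ ℚ) :=
    Matrix.of fun i j => monomial (μ i) 1 * hasse (μ i) (g j)
  have hM : M.det = 0 := by
    have := Matrix.det_mul_column (fun i => monomial (μ i) (1 : ℚ))
      (Matrix.of fun i j => hasse (μ i) (g j))
    rw [h1, mul_zero] at this
    exact this
  have hcoeff : ∀ i j β, coeff β (M i j) = multichoose β (μ i) * coeff β (g j) := by
    intro i j β
    simp only [M, Matrix.of_apply, coeff_monomial_mul', one_mul]
    split_ifs with h
    · rw [coeff_hasse, tsub_add_cancel_of_le h]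
    · rw [multichoose_eq_zero h, Nat.cast_zero, zero_mul]
  have hdeg : ∀ i j, m.toSyn (m.degree (M i j)) ≤ m.toSyn (m.degree (g j)) := by
    intro i j
    rw [m.degree_le_iff]
    intro b hb
    rw [mem_support_iff, hcoeff] at hb
    exact m.le_degree (mem_support_iff.2 (right_ne_zero_of_mul hb))
  have hc : coeff (∑ j, m.degree (g j)) M.det =
      (Matrix.of fun i j => coeff (m.degree (g j)) (M i j)).det := by
    rw [Matrix.det_apply, Matrix.det_apply, coeff_sum]
    refine Finset.sum_congr rfl fun s _ => ?_
    rw [Units.smul_def, coeff_smul, Units.smul_def,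
      (degree_prod_le_and_coeff m Finset.univ fun j _ => hdeg (s j) j).2]
    rfl
  have hc2 : (Matrix.of fun i j => coeff (m.degree (g j)) (M i j)) =
      Matrix.of fun i j => m.leadingCoeff (g j) *
        (Matrix.of fun i j => (multichoose (m.degree (g j)) (μ i) : ℚ)) i j := by
    ext i j
    simp only [Matrix.of_apply, hcoeff, MonomialOrder.leadingCoeff]
    ring
  rw [hM, coeff_zero, hc2, Matrix.det_mul_row] at hc
  refine mul_ne_zero (Finset.prod_ne_zero_iff.2 fun j _ => ?_) hdet hc.symm
  exact m.leadingCoeff_ne_zero_iff.2 (hA0 j)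

end Wronskian

lemma translate_neg_translate {σ R : Type*} [CommRing R] (c : σ → R) (P : MvPolynomial σ R) :
    translate (-c) (translate c P) = P := by
  induction P using MvPolynomial.induction_on with
  | C a => simp [translate]
  | add p q hp hq => rw [map_add, map_add, hp, hq]
  | mul_X p i hp =>
    rw [map_mul, map_mul, hp]
    simp [translate]

lemma translate_ne_zero {σ R : Type*} [CommRing R] (c : σ → R) {P : MvPolynomial σ R}
    (hP : P ≠ 0) : translate c P ≠ 0 := fun h => hP (by
  rw [← translate_neg_translate c P, h, map_zero])

lemma uniqueAlgEquiv_translate (c : Fin 1 → ℚ) (P : MvPolynomial (Fin 1) ℚ) :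
    uniqueAlgEquiv ℚ (Fin 1) (translate c P) =
      (uniqueAlgEquiv ℚ (Fin 1) P).comp (Polynomial.X + Polynomial.C (c 0)) := by
  induction P using MvPolynomial.induction_on with
  | C a => simp [translate, uniqueAlgEquiv]
  | add p q hp hq => simp only [map_add, hp, hq, Polynomial.add_comp]
  | mul_X p i hp =>
    rw [map_mul, map_mul, hp, map_mul, Polynomial.mul_comp]
    simp [translate, uniqueAlgEquiv, Subsingleton.elim i 0]

lemma isPrimitive_den_mul_X_sub_num (c : ℚ) (t : ℕ) :
    ((Polynomial.C (c.den : ℤ) * Polynomial.X - Polynomial.C c.num) ^ t).IsPrimitive := by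
  have h : (Polynomial.C (c.den : ℤ) * Polynomial.X - Polynomial.C c.num).IsPrimitive := by
    intro a ha
    rw [Polynomial.C_dvd_iff_dvd_coeff] at ha
    have h0 : a ∣ c.num := by simpa using ha 0
    have h1 : a ∣ c.den := by
      have := ha 1
      rwa [Polynomial.coeff_sub, Polynomial.coeff_C_mul, Polynomial.coeff_X_one,
        Polynomial.coeff_C_of_ne_zero one_ne_zero, mul_one, sub_zero] at this
    have := Int.isCoprime_iff_gcd_eq_one.2 (show Int.gcd c.num c.den = 1 from c.reduced)
    exact this.isUnit_of_dvd' h0 h1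
  induction t with
  | zero => simp [Polynomial.isPrimitive_one]
  | succ t ih => rw [pow_succ]; exact ih.mul h

/-- A one-variable integer polynomial of small length has small order of vanishing at a rational
point of large denominator. -/
lemma exists_coeff_translate_ne_zero {P : MvPolynomial (Fin 1) ℤ} (hP : P ≠ 0) (c : Fin 1 → ℚ) :
    ∃ ν : Fin 1 →₀ ℕ, coeff ν (translate c (map (Int.castRingHom ℚ) P)) ≠ 0 ∧
      ((c 0).den : ℝ) ^ ν 0 ≤ length P := by
  set p := uniqueAlgEquiv ℤ (Fin 1) P with hp
  set Q := translate c (map (Int.castRingHom ℚ) P) with hQ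
  set q := uniqueAlgEquiv ℚ (Fin 1) Q with hq
  have hQ0 : Q ≠ 0 := translate_ne_zero c
    ((map_ne_zero_iff _ (map_injective _ (RingHom.injective_int _))).2 hP)
  have hq0 : q ≠ 0 := (map_ne_zero_iff _ (uniqueAlgEquiv ℚ (Fin 1)).injective).2 hQ0
  have hp0 : p ≠ 0 := (map_ne_zero_iff _ (uniqueAlgEquiv ℤ (Fin 1)).injective).2 hP
  have hpmap : uniqueAlgEquiv ℚ (Fin 1) (map (Int.castRingHom ℚ) P) =
      p.map (Int.castRingHom ℚ) := by
    ext j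
    rw [coeff_uniqueAlgEquiv, coeff_map, Polynomial.coeff_map, hp, coeff_uniqueAlgEquiv]
  have hqp : q = (p.map (Int.castRingHom ℚ)).comp (Polynomial.X + Polynomial.C (c 0)) := by
    rw [hq, hQ, uniqueAlgEquiv_translate, hpmap]
  set t := q.natTrailingDegree with ht
  refine ⟨Finsupp.single default t, ?_, ?_⟩
  · rw [← coeff_uniqueAlgEquiv]
    exact Polynomial.trailingCoeff_nonzero_iff_nonzero.2 hq0
  · have h1 : Polynomial.X ^ t ∣ q := by
      rw [Polynomial.X_pow_dvd_iff]
      exact fun d hd => Polynomial.coeff_eq_zero_of_lt_natTrailingDegree hd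
    have h2 : (Polynomial.X - Polynomial.C (c 0)) ^ t ∣ p.map (Int.castRingHom ℚ) := by
      obtain ⟨s, hs⟩ := h1
      refine ⟨s.comp (Polynomial.X - Polynomial.C (c 0)), ?_⟩
      have := congrArg (fun f => Polynomial.comp f (Polynomial.X - Polynomial.C (c 0)))
        (hqp.symm.trans hs)
      simpa [Polynomial.comp_assoc] using this
    have h3 : (Polynomial.C ((c 0).den : ℤ) * Polynomial.X - Polynomial.C (c 0).num) ^ t ∣ p := by
      rw [Polynomial.IsPrimitive.Int.dvd_iff_map_cast_dvd_map_cast _ _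
        (isPrimitive_den_mul_X_sub_num _ _)]
      have hd : ((c 0).den : ℚ) ≠ 0 := by exact_mod_cast (c 0).den_ne_zero
      have : (Polynomial.C ((c 0).den : ℤ) * Polynomial.X - Polynomial.C (c 0).num).map
          (Int.castRingHom ℚ) = Polynomial.C ((c 0).den : ℚ) *
            (Polynomial.X - Polynomial.C (c 0)) := by
        have h4 : (Polynomial.C ((c 0).num : ℚ)) =
            Polynomial.C ((c 0).den : ℚ) * Polynomial.C (c 0) := by
          rw [← Polynomial.C_mul, Rat.den_mul_eq_num]
        rw [mul_sub, ← h4]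
        simp
      rw [Polynomial.map_pow, this, mul_pow, ← Polynomial.C_pow]
      have hu : IsUnit (Polynomial.C (((c 0).den : ℚ) ^ t)) :=
        Polynomial.isUnit_C.2 (isUnit_iff_ne_zero.2 (pow_ne_zero _ hd))
      exact hu.mul_left_dvd.2 h2
    have h4 : ((c 0).den : ℤ) ^ t ∣ p.leadingCoeff := by
      have h5 := Polynomial.leadingCoeff_dvd_leadingCoeff h3
      have h6 : (Polynomial.C ((c 0).den : ℤ) * Polynomial.X - Polynomial.C (c 0).num).leadingCoeff
          = ((c 0).den : ℤ) := by
        rw [sub_eq_add_neg, ← Polynomial.C_neg, Polynomial.leadingCoeff_linear]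
        exact_mod_cast (c 0).den_ne_zero
      rwa [Polynomial.leadingCoeff_pow, h6] at h5
    have h5 := Int.le_of_dvd (abs_pos.2 (Polynomial.leadingCoeff_ne_zero.2 hp0))
      ((dvd_abs _ _).2 h4)
    have h6 := norm_coeff_le_length P (Finsupp.single default p.natDegree)
    rw [← coeff_uniqueAlgEquiv, ← hp, Polynomial.coeff_natDegree, Int.norm_eq_abs] at h6
    refine le_trans ?_ h6
    have h7 : (Finsupp.single (default : Fin 1) t) 0 = t := by simp [Fin.default_eq_zero]
    rw [h7]
    exact_mod_cast h5

section Tensor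

variable {n : ℕ} {R : Type*} [CommRing R]

/-- The product of a polynomial in the variables `1, …, n` and a polynomial in the variable `0`. -/
noncomputable def tensor (U : MvPolynomial (Fin n) R) (V : MvPolynomial (Fin 1) R) :
    MvPolynomial (Fin (n + 1)) R :=
  rename Fin.succ U * rename (fun _ => 0) V

lemma multichoose_cons (b ν : ℕ) (a μ : Fin n →₀ ℕ) :
    multichoose (Finsupp.cons b a) (Finsupp.cons ν μ) = b.choose ν * multichoose a μ := by
  rw [multichoose, Fin.prod_univ_succ]
  simp [multichoose]

lemma coeff_tensor (U : MvPolynomial (Fin n) R) (V : MvPolynomial (Fin 1) R) (b : ℕ)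
    (a : Fin n →₀ ℕ) :
    coeff (Finsupp.cons b a) (tensor U V) = coeff a U * coeff (Finsupp.single 0 b) V := by
  classical
  induction U using MvPolynomial.induction_on' with
  | add p q hp hq =>
    rw [tensor, map_add, add_mul, coeff_add, ← tensor, ← tensor, hp, hq, coeff_add, add_mul]
  | monomial α u =>
    induction V using MvPolynomial.induction_on' with
    | add p q hp hq =>
      rw [tensor, map_add, mul_add, coeff_add, ← tensor, ← tensor, hp, hq, coeff_add, mul_add]
    | monomial β v =>
      have h : Finsupp.mapDomain Fin.succ α + Finsupp.mapDomain (fun _ => (0 : Fin (n + 1))) β =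
          Finsupp.cons (β 0) α := by
        ext i
        rw [Finsupp.add_apply]
        refine Fin.cases ?_ (fun j => ?_) i
        · rw [Finsupp.mapDomain_of_notMem_range, Finsupp.cons_zero, zero_add]
          · exact Finsupp.mapDomain_apply (f := fun _ : Fin 1 => (0 : Fin (n + 1)))
              (fun _ _ _ => Subsingleton.elim _ _) β 0
          · rintro ⟨j, hj⟩
            exact Fin.succ_ne_zero j hj
        · rw [Finsupp.mapDomain_apply (Fin.succ_injective _), Finsupp.mapDomain_of_notMem_range,
            Finsupp.cons_succ, add_zero]
          rintro ⟨l, hl⟩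
          exact Fin.succ_ne_zero j hl.symm
      rw [tensor, rename_monomial, rename_monomial, monomial_mul, h, coeff_monomial, coeff_monomial,
        coeff_monomial]
      have h1 : Finsupp.cons (β 0) α = Finsupp.cons b a ↔
          α = a ∧ β = Finsupp.single 0 b := by
        constructor
        · intro h
          refine ⟨(Finsupp.cons_injective2 h).2, ?_⟩
          refine Finsupp.ext fun i => ?_
          rw [Subsingleton.elim i 0, (Finsupp.cons_injective2 h).1]
          simp
        · rintro ⟨rfl, rfl⟩
          simp
      simp only [h1]
      split_ifs <;> simp_all

lemma ext_cons {P Q : MvPolynomial (Fin (n + 1)) R}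
    (h : ∀ b a, coeff (Finsupp.cons b a) P = coeff (Finsupp.cons b a) Q) : P = Q := by
  ext α
  rw [← Finsupp.cons_tail α]
  exact h _ _

lemma translate_tensor (c : Fin (n + 1) → R) (U : MvPolynomial (Fin n) R)
    (V : MvPolynomial (Fin 1) R) :
    translate c (tensor U V) =
      tensor (translate (fun i => c i.succ) U) (translate (fun _ => c 0) V) := by
  rw [tensor, tensor, map_mul]
  congr 1
  · rw [translate, translate, aeval_rename, ← AlgHom.comp_apply, comp_aeval]
    congr 2
    funext i
    simp
  · rw [translate, translate, aeval_rename, ← AlgHom.comp_apply, comp_aeval]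
    congr 2
    funext i
    simp

lemma hasse_tensor (ν : ℕ) (μ : Fin n →₀ ℕ) (U : MvPolynomial (Fin n) R)
    (V : MvPolynomial (Fin 1) R) :
    hasse (Finsupp.cons ν μ) (tensor U V) =
      tensor (hasse μ U) (hasse (Finsupp.single 0 ν) V) := by
  refine ext_cons fun b a => ?_
  have h : Finsupp.cons b a + Finsupp.cons ν μ = Finsupp.cons (b + ν) (a + μ) := by
    ext i
    refine Fin.cases ?_ (fun j => ?_) i <;> simp
  rw [coeff_hasse, h, coeff_tensor, coeff_tensor, coeff_hasse, coeff_hasse, multichoose_cons,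
    ← Finsupp.single_add]
  simp only [multichoose, Finset.univ_unique, Finset.prod_singleton, Fin.default_eq_zero,
    Finsupp.single_eq_same]
  push_cast
  ring

end Tensor

section Slice

variable {σ τ R : Type*} [CommRing R] {e : (τ →₀ ℕ) → σ →₀ ℕ}

/-- The polynomial whose coefficient at `α` is the coefficient of `P` at `e α`. -/
noncomputable def slice (he : Function.Injective e) (P : MvPolynomial σ R) : MvPolynomial τ R :=
  ∑ α ∈ P.support.preimage e he.injOn, monomial α (coeff (e α) P)

lemma coeff_slice (he : Function.Injective e) (P : MvPolynomial σ R) (α : τ →₀ ℕ) :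
    coeff α (slice he P) = coeff (e α) P := by
  classical
  rw [slice, coeff_sum]
  simp only [coeff_monomial]
  rw [Finset.sum_ite_eq']
  split_ifs with h
  · rfl
  · rw [Finset.mem_preimage, notMem_support_iff] at h
    exact h.symm

lemma length_slice_le {R : Type*} [NormedCommRing R] (he : Function.Injective e)
    (P : MvPolynomial σ R) : length (slice he P) ≤ length P := by
  classical
  rw [length]
  simp only [coeff_slice]
  rw [← Finset.sum_image (f := fun β => ‖coeff β P‖) (g := e) he.injOn]
  exact sum_norm_coeff_le_length _ _

end Slice

lemma exists_eq_sum_tensor {n : ℕ} {P : MvPolynomial (Fin (n + 1)) ℚ} (hP : P ≠ 0) {d : ℕ}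
    (hd : degreeOf 0 P ≤ d) :
    ∃ k, 0 < k ∧ k ≤ d + 1 ∧ ∃ (f : Fin k → MvPolynomial (Fin n) ℚ)
      (g : Fin k → MvPolynomial (Fin 1) ℚ), LinearIndependent ℚ f ∧ LinearIndependent ℚ g ∧
        P = ∑ j, tensor (f j) (g j) := by
  classical
  set F : Fin (d + 1) → MvPolynomial (Fin n) ℚ :=
    fun b => slice (Finsupp.cons_injective2.right (b : ℕ)) P with hF
  set V := Submodule.span ℚ (Set.range F) with hV
  have hFV : ∀ b, F b ∈ V := fun b => Submodule.subset_span ⟨b, rfl⟩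
  have : Module.Finite ℚ V := FiniteDimensional.span_of_finite ℚ (Set.finite_range F)
  set B := Module.finBasis ℚ V
  set g : Fin (Module.finrank ℚ V) → MvPolynomial (Fin 1) ℚ := fun j =>
    ∑ b : Fin (d + 1), monomial (Finsupp.single 0 (b : ℕ)) (B.repr ⟨F b, hFV b⟩ j) with hg
  have hgc : ∀ j (b : Fin (d + 1)),
      coeff (Finsupp.single 0 (b : ℕ)) (g j) = B.repr ⟨F b, hFV b⟩ j := by
    intro j b
    rw [hg, coeff_sum]
    simp only [coeff_monomial]
    rw [Finset.sum_eq_single b]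
    · simp
    · intro b' _ hb'
      rw [if_neg]
      intro h
      exact hb' (Fin.ext (Finsupp.single_injective _ h))
    · simp
  have hgc' : ∀ j b, d < b → coeff (Finsupp.single 0 b) (g j) = 0 := by
    intro j b hb
    rw [hg, coeff_sum]
    refine Finset.sum_eq_zero fun b' _ => ?_
    rw [coeff_monomial, if_neg]
    intro h
    have := Finsupp.single_injective _ h
    have := b'.2
    omega
  have hPsum : P = ∑ j, tensor (B j : MvPolynomial (Fin n) ℚ) (g j) := by
    refine ext_cons fun b a => ?_
    rw [coeff_sum]
    simp only [coeff_tensor]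
    by_cases hb : d < b
    · simp only [hgc' _ b hb, mul_zero, Finset.sum_const_zero]
      by_contra h
      have := le_degreeOf_of_mem_support (i := 0) (mem_support_iff.2 h)
      rw [Finsupp.cons_zero] at this
      omega
    · have h1 := B.sum_repr ⟨F ⟨b, by omega⟩, hFV _⟩
      have h2 := congrArg (fun v : V => coeff a (v : MvPolynomial (Fin n) ℚ)) h1
      simp only [Submodule.coe_sum, Submodule.coe_smul, coeff_sum, coeff_smul, smul_eq_mul] at h2
      rw [← coeff_slice (Finsupp.cons_injective2.right b) P a]
      refine h2.symm.trans ?_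
      refine Finset.sum_congr rfl fun j _ => ?_
      rw [hgc j ⟨b, by omega⟩, mul_comm]
  refine ⟨Module.finrank ℚ V, ?_, ?_, fun j => B j, g, ?_, ?_, hPsum⟩
  · by_contra h
    have : IsEmpty (Fin (Module.finrank ℚ V)) := by
      rw [Nat.pos_iff_ne_zero, not_not] at h
      rw [h]
      infer_instance
    exact hP (hPsum.trans (Fintype.sum_empty _))
  · exact (finrank_range_le_card (R := ℚ) F).trans_eq (Fintype.card_fin _)
  · exact B.linearIndependent.map' V.subtype (Submodule.ker_subtype _)
  · rw [Fintype.linearIndependent_iff]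
    intro c hc
    set φ := B.constr ℚ c with hφ
    have hφF : ∀ b, φ ⟨F b, hFV b⟩ = 0 := by
      intro b
      have := congrArg (coeff (Finsupp.single 0 (b : ℕ))) hc
      simp only [coeff_sum, coeff_smul, smul_eq_mul, hgc, coeff_zero] at this
      rw [hφ, B.constr_apply_fintype ℚ, ← this]
      refine Finset.sum_congr rfl fun j _ => ?_
      rw [Module.Basis.equivFun_apply, smul_eq_mul, mul_comm]
    have hφ0 : ∀ x (hx : x ∈ V), φ ⟨x, hx⟩ = 0 := by
      intro x hx
      induction hx using Submodule.span_induction with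
      | mem x h => obtain ⟨b, rfl⟩ := h; exact hφF b
      | zero => exact φ.map_zero
      | add x y hx hy ihx ihy =>
        have := φ.map_add ⟨x, hx⟩ ⟨y, hy⟩
        rw [ihx, ihy, add_zero] at this
        exact this
      | smul a x hx ih =>
        have := φ.map_smul a ⟨x, hx⟩
        rw [ih, smul_zero] at this
        exact this
    intro j
    rw [← B.constr_basis ℚ c j]
    exact hφ0 _ (B j).2

lemma exists_det_hasse_eq_tensor {n : ℕ} {P : MvPolynomial (Fin (n + 1)) ℤ} (hP : P ≠ 0) {d : ℕ}
    (hd : degreeOf 0 P ≤ d) :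
    ∃ k, 0 < k ∧ k ≤ d + 1 ∧ ∃ (ν : Fin k → ℕ) (μ : Fin k → Fin n →₀ ℕ)
      (U : MvPolynomial (Fin n) ℚ) (V : MvPolynomial (Fin 1) ℚ), U ≠ 0 ∧ V ≠ 0 ∧
        Function.Injective ν ∧ (∀ j, ν j < k) ∧ (∀ i, ∑ l, μ i l < k) ∧
        map (Int.castRingHom ℚ) (Matrix.of fun i j => hasse (Finsupp.cons (ν j) (μ i)) P).det =
          tensor U V := by
  have hQ : map (Int.castRingHom ℚ) P ≠ 0 :=
    (map_ne_zero_iff _ (map_injective _ (RingHom.injective_int _))).2 hP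
  have hdQ : degreeOf 0 (map (Int.castRingHom ℚ) P) ≤ d := by
    rw [degreeOf_le_iff] at hd ⊢
    exact fun m hm => hd m (support_map_subset _ _ hm)
  obtain ⟨k, hk, hkd, f, g, hf, hg, hfg⟩ := exists_eq_sum_tensor hQ hdQ
  obtain ⟨μ, hμ, hU⟩ := exists_wronskian_ne_zero hf
  obtain ⟨ν, hν, hV⟩ := exists_wronskian_ne_zero hg
  have hν1 : ∀ j, ν j = Finsupp.single 0 (ν j 0) := fun j =>
    Finsupp.ext fun i => by rw [Subsingleton.elim i 0, Finsupp.single_eq_same]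
  refine ⟨k, hk, hkd, fun j => ν j 0, μ, _, _, hU, hV, ?_, ?_, hμ, ?_⟩
  · intro i j hij
    by_contra h
    refine hV (Matrix.det_zero_of_row_eq h ?_)
    funext l
    simp only [Matrix.of_apply]
    rw [hν1 i, hν1 j, show ν i 0 = ν j 0 from hij]
  · intro j
    simpa using hν j
  · rw [← Matrix.det_transpose (Matrix.of fun i j => hasse (ν i) (g j)), tensor, AlgHom.map_det,
      AlgHom.map_det, ← Matrix.det_mul, RingHom.map_det]
    congr 1
    ext1 i j
    rw [RingHom.mapMatrix_apply, Matrix.map_apply, Matrix.of_apply, ← hasse_map, hfg, map_sum,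
      Matrix.mul_apply]
    refine Finset.sum_congr rfl fun l _ => ?_
    rw [hasse_tensor, ← hν1, tensor]
    rfl

lemma exists_slices {n : ℕ} {W : MvPolynomial (Fin (n + 1)) ℤ} {U : MvPolynomial (Fin n) ℚ}
    {V : MvPolynomial (Fin 1) ℚ} (hU : U ≠ 0) (hV : V ≠ 0)
    (h : map (Int.castRingHom ℚ) W = tensor U V) :
    ∃ (U' : MvPolynomial (Fin n) ℤ) (V' : MvPolynomial (Fin 1) ℤ), U' ≠ 0 ∧ V' ≠ 0 ∧
      length U' ≤ length W ∧ length V' ≤ length W ∧ (∀ i, degreeOf i U' ≤ degreeOf i.succ W) ∧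
      ∀ (c : Fin (n + 1) → ℚ) (ν : Fin 1 →₀ ℕ) (μ : Fin n →₀ ℕ),
        coeff ν (translate (fun _ => c 0) (map (Int.castRingHom ℚ) V')) ≠ 0 →
        coeff μ (translate (fun i => c i.succ) (map (Int.castRingHom ℚ) U')) ≠ 0 →
        coeff (Finsupp.cons (ν 0) μ) (translate c (map (Int.castRingHom ℚ) W)) ≠ 0 := by
  classical
  have hν1 : ∀ ν : Fin 1 →₀ ℕ, ν = Finsupp.single 0 (ν 0) := fun ν =>
    Finsupp.ext fun i => by rw [Subsingleton.elim i 0, Finsupp.single_eq_same]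
  obtain ⟨a, ha⟩ := ne_zero_iff.1 hU
  obtain ⟨b, hb⟩ := ne_zero_iff.1 hV
  have hinj : Function.Injective fun ν : Fin 1 →₀ ℕ => Finsupp.cons (ν 0) a := by
    intro x y hxy
    rw [hν1 x, hν1 y, (Finsupp.cons_injective2 hxy).1]
  have hW : ∀ (ν : Fin 1 →₀ ℕ) μ, ((coeff (Finsupp.cons (ν 0) μ) W : ℤ) : ℚ) = coeff μ U * coeff ν V := by
    intro ν μ
    rw [hν1 ν, ← coeff_tensor, ← h, coeff_map]
    simp
  have hU' : map (Int.castRingHom ℚ) (slice (Finsupp.cons_injective2.right (b 0)) W) =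
      coeff b V • U := by
    ext μ
    rw [coeff_map, coeff_slice, eq_intCast, hW, coeff_smul, smul_eq_mul, mul_comm]
  have hV' : map (Int.castRingHom ℚ) (slice hinj W) = coeff a U • V := by
    ext ν
    rw [coeff_map, coeff_slice, eq_intCast, hW, coeff_smul, smul_eq_mul]
  refine ⟨slice (Finsupp.cons_injective2.right (b 0)) W, slice hinj W, ?_, ?_,
    length_slice_le _ _, length_slice_le _ _, ?_, ?_⟩
  · intro h0
    rw [h0, map_zero] at hU'
    exact smul_ne_zero hb hU hU'.symm
  · intro h0
    rw [h0, map_zero] at hV'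
    exact smul_ne_zero ha hV hV'.symm
  · intro i
    rw [degreeOf_le_iff]
    intro m hm
    rw [mem_support_iff, coeff_slice] at hm
    have := le_degreeOf_of_mem_support (i := i.succ) (mem_support_iff.2 hm)
    rwa [Finsupp.cons_succ] at this
  · intro c ν μ h1 h2
    rw [hV', map_smul, coeff_smul, smul_eq_mul] at h1
    rw [hU', map_smul, coeff_smul, smul_eq_mul] at h2
    rw [h, translate_tensor, coeff_tensor, ← hν1]
    exact mul_ne_zero (right_ne_zero_of_mul h2) (right_ne_zero_of_mul h1)

lemma degreeOf_det_le {σ R : Type*} [CommRing R] {k d : ℕ} {l : σ}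
    {M : Matrix (Fin k) (Fin k) (MvPolynomial σ R)} (h : ∀ i j, degreeOf l (M i j) ≤ d) :
    degreeOf l M.det ≤ k * d := by
  classical
  rw [Matrix.det_apply]
  refine (degreeOf_sum_le _ _ _).trans (Finset.sup_le fun τ _ => ?_)
  have h1 : degreeOf l (∏ i, M (τ i) i) ≤ k * d :=
    (degreeOf_prod_le _ _ _).trans ((Finset.sum_le_sum fun i _ => h _ _).trans (by simp))
  rcases Int.units_eq_one_or (Equiv.Perm.sign τ) with hs | hs
  · rwa [hs, one_smul]
  · rwa [hs, Units.neg_smul, one_smul, degreeOf_neg]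

lemma le_sum_max_sub_div {k d : ℕ} (hd : 0 < d) (hk : k ≤ d + 1) {t : ℝ} (ht : 0 ≤ t)
    (ht1 : t ≤ 1) : k * t ^ 2 / 8 ≤ ∑ j ∈ Finset.range k, max 0 (t - j / d) := by
  have hd' : (0 : ℝ) < d := by exact_mod_cast hd
  set m := min k (⌊t * d / 2⌋₊ + 1) with hm
  have hfl : (⌊t * d / 2⌋₊ : ℝ) ≤ t * d / 2 := Nat.floor_le (by positivity)
  have hm2 : (k : ℝ) * t / 4 ≤ m := by
    have hkd : (k : ℝ) ≤ 2 * d := by exact_mod_cast (by omega : k ≤ 2 * d)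
    rw [hm]
    push_cast
    refine le_min ?_ ?_
    · have : (k : ℝ) * t ≤ k * 1 := mul_le_mul_of_nonneg_left ht1 (Nat.cast_nonneg k)
      have : (0 : ℝ) ≤ k := Nat.cast_nonneg k
      linarith
    · have := Nat.lt_floor_add_one (t * d / 2)
      have : (k : ℝ) * t ≤ 2 * d * t := mul_le_mul_of_nonneg_right hkd ht
      linarith
  calc (k : ℝ) * t ^ 2 / 8 = k * t / 4 * (t / 2) := by ring
    _ ≤ m * (t / 2) := mul_le_mul_of_nonneg_right hm2 (by linarith)
    _ = ∑ j ∈ Finset.range m, t / 2 := by simp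
    _ ≤ ∑ j ∈ Finset.range m, max 0 (t - j / d) := by
      refine Finset.sum_le_sum fun j hj => le_max_of_le_right ?_
      rw [Finset.mem_range] at hj
      have h1 : j ≤ ⌊t * d / 2⌋₊ := by omega
      have h2 : (j : ℝ) ≤ t * d / 2 := le_trans (by exact_mod_cast h1) hfl
      have h3 : (j : ℝ) / d ≤ t / 2 := by
        rw [div_le_iff₀ hd']
        linarith
      linarith
    _ ≤ _ := Finset.sum_le_sum_of_subset_of_nonneg
      (Finset.range_subset_range.2 (min_le_left _ _)) fun _ _ _ => le_max_left _ _

lemma sum_comp_eq_sum_range {k : ℕ} {ν : Fin k → ℕ} (hν : Function.Injective ν)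
    (hk : ∀ j, ν j < k) (f : ℕ → ℝ) : ∑ j, f (ν j) = ∑ j ∈ Finset.range k, f j := by
  have h : Finset.image ν Finset.univ = Finset.range k := by
    refine Finset.eq_of_subset_of_card_le ?_ ?_
    · intro j hj
      obtain ⟨i, _, rfl⟩ := Finset.mem_image.1 hj
      exact Finset.mem_range.2 (hk i)
    · rw [Finset.card_image_of_injective _ hν]
      simp
  rw [← h, Finset.sum_image hν.injOn]

/-- **Roth's lemma**: an integer polynomial of small height has small index at a rational point
whose coordinates have large denominators. -/
theorem exists_coeff_translate_ne_zero_lt (n : ℕ) : ∀ δ : ℝ, 0 < δ → ∃ ρ : ℝ, 0 < ρ ∧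
    ∀ (r : Fin n → ℕ) (c : Fin n → ℚ) (P : MvPolynomial (Fin n) ℤ), (∀ i, 0 < r i) →
      (∀ i j, i < j → (r i : ℝ) ≤ ρ * r j) → P ≠ 0 → (∀ i, degreeOf i P ≤ r i) →
      (∀ i, 2 ^ (∑ j, r j) * length P ≤ ((c i).den : ℝ) ^ (ρ * r i)) →
      ∃ μ, coeff μ (translate c (map (Int.castRingHom ℚ) P)) ≠ 0 ∧
        ∑ i, (μ i : ℝ) / r i < δ := by
  induction n with
  | zero =>
    intro δ hδ
    refine ⟨1, one_pos, fun r c P _ _ hP _ _ => ?_⟩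
    obtain ⟨μ, hμ⟩ := ne_zero_iff.1 (translate_ne_zero c
      ((map_ne_zero_iff _ (map_injective _ (RingHom.injective_int (Int.castRingHom ℚ)))).2 hP))
    exact ⟨μ, hμ, by simpa using hδ⟩
  | succ n ih =>
    suffices H : ∀ δ : ℝ, 0 < δ → δ ≤ 1 → ∃ ρ : ℝ, 0 < ρ ∧
        ∀ (r : Fin (n + 1) → ℕ) (c : Fin (n + 1) → ℚ) (P : MvPolynomial (Fin (n + 1)) ℤ),
          (∀ i, 0 < r i) → (∀ i j, i < j → (r i : ℝ) ≤ ρ * r j) → P ≠ 0 →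
          (∀ i, degreeOf i P ≤ r i) →
          (∀ i, 2 ^ (∑ j, r j) * length P ≤ ((c i).den : ℝ) ^ (ρ * r i)) →
          ∃ μ, coeff μ (translate c (map (Int.castRingHom ℚ) P)) ≠ 0 ∧
            ∑ i, (μ i : ℝ) / r i < δ by
      intro δ hδ
      obtain ⟨ρ, hρ, h⟩ := H (min δ 1) (lt_min hδ one_pos) (min_le_right _ _)
      refine ⟨ρ, hρ, fun r c P h1 h2 h3 h4 h5 => ?_⟩
      obtain ⟨μ, hμ, hμ'⟩ := h r c P h1 h2 h3 h4 h5
      exact ⟨μ, hμ, hμ'.trans_le (min_le_left _ _)⟩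
    intro δ hδ hδ1
    obtain ⟨ρ', hρ', IH⟩ := ih (δ ^ 2 / 64) (by positivity)
    set ρ := min (ρ' / 3) (δ ^ 2 / 256) with hρ
    have hρ0 : 0 < ρ := lt_min (by positivity) (by positivity)
    have hρ1 : ρ ≤ ρ' / 3 := min_le_left _ _
    have hρ2 : ρ ≤ δ ^ 2 / 256 := min_le_right _ _
    refine ⟨ρ, hρ0, fun r c P hr hrr hP hdeg hlen => ?_⟩
    by_contra hcon
    push Not at hcon
    have hr' : ∀ i, (0 : ℝ) < r i := fun i => by exact_mod_cast hr i
    obtain ⟨k, hk, hkr, ν, μ, U, V, hU, hV, hνinj, hνk, hμk, hW⟩ :=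
      exists_det_hasse_eq_tensor hP (hdeg 0)
    set W := (Matrix.of fun i j => hasse (Finsupp.cons (ν j) (μ i)) P).det with hWdef
    set H : ℝ := 2 ^ (∑ j, r j) * length P with hH
    have hL1 : 1 ≤ length P := by
      obtain ⟨α, hα⟩ := ne_zero_iff.1 hP
      refine le_trans ?_ (norm_coeff_le_length P α)
      rw [Int.norm_eq_abs]
      exact_mod_cast Int.one_le_abs hα
    have hrH : (2 : ℝ) ^ (∑ j, r j) ≤ H := by
      rw [hH]
      exact le_mul_of_one_le_right (by positivity) hL1
    have hkH : (k : ℝ) ≤ H := by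
      refine le_trans ?_ hrH
      have h1 : r 0 ≤ ∑ j, r j := Finset.single_le_sum (fun _ _ => Nat.zero_le _) (Finset.mem_univ 0)
      have h2 : k ≤ 2 ^ ∑ j, r j :=
        hkr.trans ((Nat.lt_two_pow_self).trans_le (Nat.pow_le_pow_right two_pos h1))
      exact_mod_cast h2
    have hH2 : 2 ≤ H := by
      refine le_trans ?_ hrH
      refine le_self_pow₀ one_le_two ?_
      exact (lt_of_lt_of_le (hr 0)
        (Finset.single_le_sum (fun _ _ => Nat.zero_le _) (Finset.mem_univ 0))).ne'
    have hH0 : 0 < H := by linarith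
    have hWlen : length W ≤ H ^ (2 * k) := by
      have h1 : length W ≤ k.factorial * H ^ k := by
        refine length_det_le fun i j => ?_
        exact length_hasse_le _ r P hdeg
      have h2 : (k.factorial : ℝ) ≤ H ^ k :=
        le_trans (by exact_mod_cast Nat.factorial_le_pow k)
          (pow_le_pow_left₀ (Nat.cast_nonneg _) hkH k)
      calc length W ≤ k.factorial * H ^ k := h1
        _ ≤ H ^ k * H ^ k := mul_le_mul_of_nonneg_right h2 (by positivity)
        _ = H ^ (2 * k) := by rw [two_mul, pow_add]
    have hWdeg : ∀ i, degreeOf i W ≤ k * r i := fun i =>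
      degreeOf_det_le fun _ _ => (degreeOf_hasse_le _ _ _).trans (hdeg i)
    -- the Wronskian vanishes to high order
    set t := δ - ρ with ht
    have ht2 : δ / 2 ≤ t := by
      have : δ ^ 2 ≤ δ := by nlinarith
      linarith
    have hvan : VanishesTo c r (k * t ^ 2 / 8) (map (Int.castRingHom ℚ) W) := by
      have h0 : VanishesTo c r δ (map (Int.castRingHom ℚ) P) := by
        intro β hβ
        by_contra h
        exact absurd (hcon β h) (not_le.2 hβ)
      have h1 : VanishesTo c r (∑ j, max 0 (t - (ν j : ℝ) / r 0))
          (map (Int.castRingHom ℚ) W) := by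
        rw [hWdef, RingHom.map_det]
        refine VanishesTo.det fun i j => ?_
        rw [RingHom.mapMatrix_apply, Matrix.map_apply, Matrix.of_apply, ← hasse_map]
        rcases le_or_gt (t - (ν j : ℝ) / r 0) 0 with h | h
        · rw [max_eq_left h]
          exact vanishesTo_of_nonpos le_rfl
        · rw [max_eq_right h.le]
          refine (h0.hasse _).mono ?_
          rw [Fin.sum_univ_succ]
          simp only [Finsupp.cons_zero, Finsupp.cons_succ]
          have h2 : ∑ l : Fin n, (μ i l : ℝ) / r l.succ ≤ ρ := by
            calc ∑ l : Fin n, (μ i l : ℝ) / r l.succ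
                ≤ ∑ l : Fin n, (μ i l : ℝ) * (ρ / r 0) := by
                  refine Finset.sum_le_sum fun l _ => ?_
                  rw [div_eq_mul_one_div]
                  refine mul_le_mul_of_nonneg_left ?_ (Nat.cast_nonneg _)
                  rw [div_le_div_iff₀ (hr' _) (hr' _), one_mul]
                  exact hrr 0 l.succ (Fin.succ_pos l)
              _ = ((∑ l, μ i l : ℕ) : ℝ) * (ρ / r 0) := by
                  rw [← Finset.sum_mul]
                  push_cast
                  rfl
              _ ≤ r 0 * (ρ / r 0) := by
                  refine mul_le_mul_of_nonneg_right ?_ (div_nonneg hρ0.le (hr' 0).le)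
                  have := hμk i
                  exact_mod_cast (by omega : ∑ l, μ i l ≤ r 0)
              _ = ρ := by
                  have := (hr' 0).ne'
                  field_simp
          rw [ht]
          linarith
      refine h1.mono ?_
      rw [sum_comp_eq_sum_range hνinj hνk fun j => max 0 (t - (j : ℝ) / r 0)]
      exact le_sum_max_sub_div (hr 0) hkr (by linarith) (by linarith)
    obtain ⟨U', V', hU', hV', hUlen, hVlen, hUdeg, hUV⟩ := exists_slices hU hV hW
    obtain ⟨a, ha, ha'⟩ := exists_coeff_translate_ne_zero hV' fun _ => c 0
    have hpow : ∀ (i : Fin (n + 1)) (m : ℕ), H ^ (m * k) ≤ ((c i).den : ℝ) ^ (ρ * m * (k * r i)) := by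
      intro i m
      calc H ^ (m * k) ≤ (((c i).den : ℝ) ^ (ρ * r i)) ^ (m * k) :=
            pow_le_pow_left₀ hH0.le (hlen i) _
        _ = ((c i).den : ℝ) ^ (ρ * m * (k * r i)) := by
            rw [← Real.rpow_mul_natCast (Nat.cast_nonneg _)]
            congr 1
            push_cast
            ring
    have hden : (1 : ℝ) < (c 0).den := by
      by_contra h
      have h1 := hlen 0
      have h2 : ((c 0).den : ℝ) ^ (ρ * r 0) ≤ 1 :=
        Real.rpow_le_one (Nat.cast_nonneg _) (not_lt.1 h) (mul_nonneg hρ0.le (hr' 0).le)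
      linarith
    have haρ : (a 0 : ℝ) / r 0 ≤ 2 * ρ * k := by
      have h1 : ((c 0).den : ℝ) ^ ((a 0 : ℕ) : ℝ) ≤ ((c 0).den : ℝ) ^ (ρ * (2 : ℕ) * (k * r 0)) := by
        rw [Real.rpow_natCast]
        exact ha'.trans (hVlen.trans (hWlen.trans (hpow 0 2)))
      rw [Real.rpow_le_rpow_left_iff hden] at h1
      rw [div_le_iff₀ (hr' 0)]
      push_cast at h1
      linarith
    obtain ⟨b, hb, hb'⟩ := IH (fun i => k * r i.succ) (fun i => c i.succ) U'
      (fun i => Nat.mul_pos hk (hr _)) (fun i j hij => by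
        push_cast
        have h1 := hrr i.succ j.succ (Fin.succ_lt_succ_iff.2 hij)
        have h2 : ρ * (r j.succ : ℝ) ≤ ρ' * r j.succ :=
          mul_le_mul_of_nonneg_right (by linarith) (hr' _).le
        have h3 := mul_le_mul_of_nonneg_left (h1.trans h2) (Nat.cast_nonneg k)
        linarith) hU' (fun i => (hUdeg i).trans (hWdeg _)) (fun i => by
        have hci : (1 : ℝ) ≤ (c i.succ).den := by exact_mod_cast (c i.succ).den_pos
        calc (2 : ℝ) ^ (∑ j : Fin n, k * r j.succ) * length U' ≤ H ^ k * H ^ (2 * k) := by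
              refine mul_le_mul ?_ (hUlen.trans hWlen) (length_nonneg _) (by positivity)
              rw [← Finset.mul_sum, mul_comm, pow_mul]
              refine pow_le_pow_left₀ (by positivity) (le_trans ?_ hrH) k
              refine pow_le_pow_right₀ one_le_two ?_
              rw [Fin.sum_univ_succ]
              exact Nat.le_add_left _ _
          _ = H ^ (3 * k) := by rw [← pow_add]; congr 1; ring
          _ ≤ _ := hpow i.succ 3
          _ ≤ _ := by
              refine Real.rpow_le_rpow_of_exponent_le hci ?_
              push_cast
              refine mul_le_mul_of_nonneg_right (by linarith) ?_
              exact mul_nonneg (Nat.cast_nonneg _) (hr' _).le)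
    have hfin := hUV c a b ha hb
    have hge : (k : ℝ) * t ^ 2 / 8 ≤ ∑ i, ((Finsupp.cons (a 0) b i : ℕ) : ℝ) / r i := by
      by_contra h
      exact hfin (hvan _ (not_le.1 h))
    rw [Fin.sum_univ_succ] at hge
    simp only [Finsupp.cons_zero, Finsupp.cons_succ] at hge
    have hk' : (0 : ℝ) < k := by exact_mod_cast hk
    have hb2 : ∑ i : Fin n, (b i : ℝ) / r i.succ < k * (δ ^ 2 / 64) := by
      have : ∑ i : Fin n, (b i : ℝ) / r i.succ =
          k * ∑ i : Fin n, (b i : ℝ) / ((k * r i.succ : ℕ) : ℝ) := by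
        rw [Finset.mul_sum]
        refine Finset.sum_congr rfl fun i _ => ?_
        have := (hr' i.succ).ne'
        push_cast
        field_simp
      rw [this]
      exact mul_lt_mul_of_pos_left hb' hk'
    have ht4 : δ ^ 2 / 4 ≤ t ^ 2 := by nlinarith
    have h1 : (k : ℝ) * (δ ^ 2 / 32) ≤ k * t ^ 2 / 8 := by nlinarith
    have h2 : 2 * ρ * (k : ℝ) ≤ k * (δ ^ 2 / 128) := by nlinarith
    have h3 : 0 < (k : ℝ) * δ ^ 2 := by positivity
    linarith

lemma exists_int_solution {α β : Type*} [Fintype α] [Fintype β] (A : Matrix α β ℤ)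
    (hm : 0 < Fintype.card α) (h : 2 * Fintype.card α ≤ Fintype.card β) {B : ℝ} (hB : 1 ≤ B)
    (hA : ∀ i j, |(A i j : ℝ)| ≤ B) :
    ∃ t : β → ℤ, t ≠ 0 ∧ (∀ i, ∑ j, A i j * t j = 0) ∧
      ∀ j, |(t j : ℝ)| ≤ Fintype.card β * B := by
  let _ : SeminormedAddCommGroup (Matrix α β ℤ) := Matrix.seminormedAddCommGroup
  obtain ⟨t, ht, hAt, hnorm⟩ := Int.Matrix.exists_ne_zero_int_vec_norm_le A (by omega) hm
  refine ⟨t, ht, fun i => congrFun hAt i, fun j => ?_⟩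
  have hm' : (0 : ℝ) < Fintype.card α := by exact_mod_cast hm
  have h' : 2 * (Fintype.card α : ℝ) ≤ Fintype.card β := by exact_mod_cast h
  have hβ : (1 : ℝ) ≤ Fintype.card β := by exact_mod_cast (by omega : 1 ≤ Fintype.card β)
  have hAB : max 1 ‖A‖ ≤ B := by
    refine max_le hB ((Matrix.norm_le_iff (by linarith)).2 fun i j => ?_)
    rw [Int.norm_eq_abs]
    exact hA i j
  have h1 : (1 : ℝ) ≤ Fintype.card β * max 1 ‖A‖ :=
    one_le_mul_of_one_le_of_one_le hβ (le_max_left _ _)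
  calc |(t j : ℝ)| = ‖t j‖ := (Int.norm_eq_abs _).symm
    _ ≤ ‖t‖ := norm_le_pi_norm t j
    _ ≤ (Fintype.card β * max 1 ‖A‖) ^
          ((Fintype.card α : ℝ) / (Fintype.card β - Fintype.card α)) := hnorm
    _ ≤ (Fintype.card β * max 1 ‖A‖) ^ (1 : ℝ) := by
      refine Real.rpow_le_rpow_of_exponent_le h1 ?_
      rw [div_le_one (by linarith)]
      linarith
    _ = Fintype.card β * max 1 ‖A‖ := Real.rpow_one _
    _ ≤ Fintype.card β * B := mul_le_mul_of_nonneg_left hAB (by linarith)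

/-- Powers of an algebraic number, up to a common denominator, as integer combinations of the first
few powers. -/
lemma exists_pow_eq_sum {ξ : ℝ} {f : Polynomial ℤ} (hf : f ≠ 0) (hξ : Polynomial.aeval ξ f = 0) :
    ∃ (d : ℕ) (a : ℤ) (B : ℝ), 0 < d ∧ a ≠ 0 ∧ 1 ≤ B ∧ ∀ m s : ℕ, s ≤ m → ∃ c : Fin d → ℤ,
      (∀ k, |(c k : ℝ)| ≤ B ^ m) ∧ (a : ℝ) ^ m * ξ ^ s = ∑ k, c k * ξ ^ (k : ℕ) := by
  set a := f.leadingCoeff with ha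
  have ha0 : a ≠ 0 := Polynomial.leadingCoeff_ne_zero.2 hf
  have hsum : ∑ k ∈ Finset.range (f.natDegree + 1), (f.coeff k : ℝ) * ξ ^ k = 0 := by
    rw [← hξ, Polynomial.aeval_eq_sum_range]
    exact Finset.sum_congr rfl fun k _ => by rw [zsmul_eq_mul]
  obtain ⟨e, he⟩ : ∃ e, f.natDegree = e + 1 := by
    refine Nat.exists_eq_succ_of_ne_zero fun h0 => ha0 ?_
    rw [h0] at hsum
    simp only [zero_add, Finset.range_one, Finset.sum_singleton, pow_zero, mul_one] at hsum
    rw [ha, Polynomial.leadingCoeff, h0]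
    exact_mod_cast hsum
  have htop : (a : ℝ) * ξ ^ (e + 1) = -∑ k : Fin (e + 1), (f.coeff k : ℝ) * ξ ^ (k : ℕ) := by
    rw [he, Finset.sum_range_succ, ← he, Polynomial.coeff_natDegree, ← ha,
      he, Finset.sum_range] at hsum
    linarith
  set B : ℝ := |(a : ℝ)| + ∑ k : Fin (e + 1), |(f.coeff k : ℝ)| with hB
  have haB : |(a : ℝ)| ≤ B := by
    rw [hB]
    exact le_add_of_nonneg_right (Finset.sum_nonneg fun _ _ => abs_nonneg _)
  have ha1 : 1 ≤ |(a : ℝ)| := by exact_mod_cast Int.one_le_abs ha0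
  have hfB : ∀ k : Fin (e + 1), |(a : ℝ)| + |(f.coeff k : ℝ)| ≤ B := by
    intro k
    rw [hB]
    gcongr
    exact Finset.single_le_sum (f := fun k : Fin (e + 1) => |(f.coeff k : ℝ)|)
      (fun _ _ => abs_nonneg _) (Finset.mem_univ k)
  have hB0 : 0 ≤ B := by linarith
  refine ⟨e + 1, a, B, Nat.succ_pos _, ha0, ha1.trans haB, fun m => ?_⟩
  have hzero : ∀ m : ℕ, ∃ c : Fin (e + 1) → ℤ,
      (∀ k, |(c k : ℝ)| ≤ B ^ m) ∧ (a : ℝ) ^ m * ξ ^ 0 = ∑ k, c k * ξ ^ (k : ℕ) := by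
    intro m
    refine ⟨Fin.cons (a ^ m) fun _ => 0, fun k => ?_, ?_⟩
    · refine Fin.cases ?_ (fun j => ?_) k
      · simp only [Fin.cons_zero]
        push_cast
        rw [abs_pow]
        exact pow_le_pow_left₀ (abs_nonneg _) haB _
      · simpa using pow_nonneg hB0 m
    · rw [Fin.sum_univ_succ]
      simp
  induction m with
  | zero =>
    intro s hs
    obtain rfl : s = 0 := by omega
    exact hzero 0
  | succ m ih =>
    intro s hs
    rcases s with _ | s
    · exact hzero (m + 1)
    · obtain ⟨c, hc, hcs⟩ := ih s (by omega)
      refine ⟨fun k => (Fin.cons 0 fun j : Fin e => a * c j.castSucc : Fin (e + 1) → ℤ) k -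
        c (Fin.last e) * f.coeff k, fun k => ?_, ?_⟩
      · have h1 : |((Fin.cons 0 fun j : Fin e => a * c j.castSucc : Fin (e + 1) → ℤ) k : ℝ)| ≤
            |(a : ℝ)| * B ^ m := by
          refine Fin.cases ?_ (fun j => ?_) k
          · simp only [Fin.cons_zero, Int.cast_zero, abs_zero]
            positivity
          · simp only [Fin.cons_succ]
            push_cast
            rw [abs_mul]
            exact mul_le_mul_of_nonneg_left (hc _) (abs_nonneg _)
        push_cast
        calc _ ≤ |(a : ℝ)| * B ^ m + B ^ m * |(f.coeff k : ℝ)| := by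
              refine (abs_sub _ _).trans (add_le_add h1 ?_)
              rw [abs_mul]
              exact mul_le_mul_of_nonneg_right (hc _) (abs_nonneg _)
          _ = B ^ m * (|(a : ℝ)| + |(f.coeff k : ℝ)|) := by ring
          _ ≤ B ^ m * B := mul_le_mul_of_nonneg_left (hfB k) (pow_nonneg hB0 m)
          _ = B ^ (m + 1) := (pow_succ _ _).symm
      · have h1 : ∑ k, ((Fin.cons 0 fun j : Fin e => a * c j.castSucc : Fin (e + 1) → ℤ) k : ℝ) *
            ξ ^ (k : ℕ) = ∑ j : Fin e, a * c j.castSucc * ξ ^ ((j : ℕ) + 1) := by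
          rw [Fin.sum_univ_succ]
          simp
        push_cast
        simp only [sub_mul, Finset.sum_sub_distrib, h1, mul_assoc]
        simp only [← Finset.mul_sum]
        rw [← neg_eq_iff_eq_neg.2 htop]
        calc (a : ℝ) ^ (m + 1) * ξ ^ (s + 1) = a * ξ * (a ^ m * ξ ^ s) := by ring
          _ = _ := by
            rw [hcs, Fin.sum_univ_castSucc, mul_add, Finset.mul_sum, Finset.mul_sum]
            simp only [Fin.val_castSucc, Fin.val_last]
            rw [sub_eq_add_neg]
            congr 1
            · exact Finset.sum_congr rfl fun j _ => by ring
            · ring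

lemma sum_exp_le {r : ℕ} (hr : 0 < r) (t : ℝ) :
    ∑ j ∈ Finset.range (r + 1), Real.exp (t * (1 / 2 - j / r)) ≤
      (r + 1) * Real.exp (t ^ 2 / 8) := by
  have hr' : (0 : ℝ) < r := by exact_mod_cast hr
  have h1 : ∑ j ∈ Finset.range (r + 1), Real.exp (t * (1 / 2 - j / r)) =
      ∑ j ∈ Finset.range (r + 1), Real.exp (-(t * (1 / 2 - j / r))) := by
    rw [← Finset.sum_range_reflect]
    refine Finset.sum_congr rfl fun j hj => ?_
    rw [Finset.mem_range] at hj
    congr 1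
    have : ((r + 1 - 1 - j : ℕ) : ℝ) = r - j := by
      rw [Nat.add_sub_cancel, Nat.cast_sub (by omega)]
    rw [this]
    field_simp
    ring
  have h2 : ∑ j ∈ Finset.range (r + 1), Real.exp (t * (1 / 2 - j / r)) =
      ∑ j ∈ Finset.range (r + 1), Real.cosh (t * (1 / 2 - j / r)) := by
    simp only [Real.cosh_eq, ← Finset.sum_div, Finset.sum_add_distrib, ← h1]
    ring
  rw [h2]
  calc _ ≤ ∑ j ∈ Finset.range (r + 1), Real.exp (t ^ 2 / 8) := by
        refine Finset.sum_le_sum fun j hj => (Real.cosh_le_exp_half_sq _).trans ?_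
        rw [Real.exp_le_exp]
        have h3 : (j : ℝ) / r ≤ 1 := by
          rw [div_le_one hr']
          exact_mod_cast Nat.lt_succ_iff.1 (Finset.mem_range.1 hj)
        have h4 : (0 : ℝ) ≤ j / r := by positivity
        have h5 : (1 / 2 - (j : ℝ) / r) ^ 2 ≤ 1 / 4 := by nlinarith
        have := mul_le_mul_of_nonneg_left h5 (sq_nonneg t)
        rw [mul_pow]
        linarith
    _ = _ := by simp

lemma card_filter_sum_div_lt_le {n : ℕ} {r : Fin n → ℕ} (hr : ∀ i, 0 < r i) (η : ℝ) (hη : 0 < η) :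
    (((Fintype.piFinset fun i => Finset.range (r i + 1)).filter
        fun μ => ∑ i, (μ i : ℝ) / r i < n * (1 / 2 - η)).card : ℝ) ≤
      Real.exp (-(2 * n * η ^ 2)) * (Fintype.piFinset fun i => Finset.range (r i + 1)).card := by
  set S := Fintype.piFinset fun i => Finset.range (r i + 1) with hS
  have h1 : ∑ μ ∈ S, Real.exp (4 * η * (n / 2 - ∑ i, (μ i : ℝ) / r i)) ≤
      S.card * Real.exp (n * (2 * η ^ 2)) := by
    calc _ = ∑ μ ∈ S, ∏ i, Real.exp (4 * η * (1 / 2 - (μ i : ℝ) / r i)) := by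
          refine Finset.sum_congr rfl fun μ _ => ?_
          rw [← Real.exp_sum, ← Finset.mul_sum, Finset.sum_sub_distrib]
          simp [div_eq_mul_inv]
      _ = ∏ i, ∑ j ∈ Finset.range (r i + 1), Real.exp (4 * η * (1 / 2 - (j : ℝ) / r i)) := by
          rw [Finset.prod_univ_sum]
      _ ≤ ∏ i, (r i + 1) * Real.exp (2 * η ^ 2) := by
          refine Finset.prod_le_prod (fun i _ => Finset.sum_nonneg fun _ _ => (Real.exp_pos _).le)
            fun i _ => (sum_exp_le (hr i) _).trans_eq ?_
          congr 2
          ring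
      _ = S.card * Real.exp (n * (2 * η ^ 2)) := by
          rw [Finset.prod_mul_distrib, hS, Fintype.card_piFinset]
          simp [Real.exp_nat_mul]
  have h2 : ((S.filter fun μ => ∑ i, (μ i : ℝ) / r i < n * (1 / 2 - η)).card : ℝ) *
      Real.exp (n * (4 * η ^ 2)) ≤
        ∑ μ ∈ S, Real.exp (4 * η * (n / 2 - ∑ i, (μ i : ℝ) / r i)) := by
    rw [← nsmul_eq_mul, ← Finset.sum_const]
    refine (Finset.sum_le_sum fun μ hμ => ?_).trans
      (Finset.sum_le_sum_of_subset_of_nonneg (Finset.filter_subset _ _)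
        fun _ _ _ => (Real.exp_pos _).le)
    rw [Real.exp_le_exp]
    have := (Finset.mem_filter.1 hμ).2
    nlinarith
  have h3 := h2.trans h1
  rw [← le_div_iff₀ (Real.exp_pos _)] at h3
  refine h3.trans_eq ?_
  rw [mul_div_assoc, ← Real.exp_sub, mul_comm]
  congr 2
  ring

lemma coeff_translate_monomial {σ R : Type*} [Fintype σ] [CommRing R] (ξ : R) (α β : σ →₀ ℕ) (a : R) :
    coeff β (translate (fun _ => ξ) (monomial α a)) =
      a * (multichoose α β * ξ ^ (∑ i, α i - ∑ i, β i)) := by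
  rw [coeff_translate, hasse_monomial, eval_monomial]
  by_cases h : β ≤ α
  · have h1 : ∑ i, (α - β) i = ∑ i, α i - ∑ i, β i := by
      rw [← Finset.sum_tsub_distrib _ fun i _ => h i]
      rfl
    rw [Finsupp.prod_fintype _ _ fun _ => pow_zero _, Finset.prod_pow_eq_pow_sum, h1]
    ring
  · simp [multichoose_eq_zero h]

/-- An auxiliary polynomial of small height and of large index at an algebraic point. -/
theorem exists_vanishesTo {ξ : ℝ} {f : Polynomial ℤ} (hf : f ≠ 0) (hξ : Polynomial.aeval ξ f = 0)
    {η : ℝ} (hη : 0 < η) (hη2 : η < 1 / 2) :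
    ∃ (n : ℕ) (C : ℝ), 0 < n ∧ 1 ≤ C ∧ ∀ r : Fin n → ℕ, (∀ i, 0 < r i) →
      ∃ P : MvPolynomial (Fin n) ℤ, P ≠ 0 ∧ (∀ i, degreeOf i P ≤ r i) ∧
        length P ≤ C ^ (∑ i, r i) ∧
        VanishesTo (fun _ => ξ) r (n * (1 / 2 - η)) (map (Int.castRingHom ℝ) P) := by
  classical
  obtain ⟨d, a, B, hd, ha, hB, hpow⟩ := exists_pow_eq_sum hf hξ
  obtain ⟨n, hn⟩ := exists_nat_gt ((d : ℝ) / η ^ 2)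
  have hn0 : (0 : ℝ) < n := lt_of_le_of_lt (by positivity) hn
  refine ⟨n, 8 * B, by exact_mod_cast hn0, by linarith, fun r hr => ?_⟩
  set m := ∑ i, r i with hm
  set S := Fintype.piFinset fun i => Finset.range (r i + 1) with hS
  set T := S.filter fun μ => ∑ i, (μ i : ℝ) / r i < n * (1 / 2 - η) with hT
  set e : (Fin n → ℕ) ≃ (Fin n →₀ ℕ) := Finsupp.equivFunOnFinite.symm with he
  have hmemS : ∀ α, α ∈ S ↔ ∀ i, α i ≤ r i := by
    intro α
    simp [hS, Fintype.mem_piFinset]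
  have hscard : (S.card : ℝ) ≤ 2 ^ m := by
    have : S.card ≤ 2 ^ m := by
      rw [hS, Fintype.card_piFinset, hm, ← Finset.prod_pow_eq_pow_sum]
      refine Finset.prod_le_prod' fun i _ => ?_
      rw [Finset.card_range]
      exact Nat.lt_two_pow_self
    exact_mod_cast this
  have hTS : 2 * (T.card * d) ≤ S.card := by
    have h1 := card_filter_sum_div_lt_le hr η hη
    rw [← hS, ← hT] at h1
    have h2 : 2 * (d : ℝ) ≤ Real.exp (2 * n * η ^ 2) := by
      rw [div_lt_iff₀ (by positivity)] at hn
      have := Real.add_one_le_exp (2 * n * η ^ 2)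
      linarith
    have h3 : (2 : ℝ) * (T.card * d) ≤ S.card := by
      calc (2 : ℝ) * (T.card * d) = T.card * (2 * d) := by ring
        _ ≤ (Real.exp (-(2 * n * η ^ 2)) * S.card) * Real.exp (2 * n * η ^ 2) :=
          mul_le_mul h1 h2 (by positivity) (by positivity)
        _ = S.card := by
          rw [Real.exp_neg]
          have := (Real.exp_pos (2 * n * η ^ 2)).ne'
          field_simp
    exact_mod_cast h3
  have hT0 : 0 < T.card := by
    refine Finset.card_pos.2 ⟨0, Finset.mem_filter.2 ⟨(hmemS _).2 fun _ => Nat.zero_le _, ?_⟩⟩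
    simp only [Pi.zero_apply, Nat.cast_zero, zero_div, Finset.sum_const_zero]
    exact mul_pos hn0 (by linarith)
  have hpow' : ∀ s, ∃ c : Fin d → ℤ, s ≤ m → (∀ k, |(c k : ℝ)| ≤ B ^ m) ∧
      (a : ℝ) ^ m * ξ ^ s = ∑ k, c k * ξ ^ (k : ℕ) := by
    intro s
    by_cases h : s ≤ m
    · obtain ⟨c, hc⟩ := hpow m s h
      exact ⟨c, fun _ => hc⟩
    · exact ⟨0, fun h' => absurd h' h⟩
  choose c hc using hpow'
  have hsm : ∀ α ∈ S, ∑ i, e α i ≤ m := fun α hα => Finset.sum_le_sum fun i _ => (hmemS α).1 hα i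
  obtain ⟨t, ht0, htA, htn⟩ := exists_int_solution
    (Matrix.of fun (p : T × Fin d) (α : S) =>
      (multichoose (e α) (e p.1) : ℤ) * c (∑ i, e α i - ∑ i, e p.1 i) p.2)
    (by simpa using ⟨Finset.card_pos.1 hT0, hd⟩) (by simpa using hTS) (B := (2 * B) ^ m)
    (one_le_pow₀ (by linarith)) (fun p α => by
      rw [Matrix.of_apply]
      push_cast
      rw [abs_mul, mul_pow]
      have h1 := hsm α α.2
      refine mul_le_mul ?_ ((hc _ ((Nat.sub_le _ _).trans h1)).1 _) (abs_nonneg _) (by positivity)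
      rw [Nat.abs_cast]
      have h2 := (multichoose_le (e α) (e p.1)).trans (Nat.pow_le_pow_right two_pos h1)
      exact_mod_cast h2)
  rw [Fintype.card_coe] at htn
  set P : MvPolynomial (Fin n) ℤ := ∑ α : S, monomial (e α) (t α) with hP
  have hcoeff : ∀ α : S, coeff (e α) P = t α := by
    intro α
    rw [hP, coeff_sum, Finset.sum_eq_single α]
    · rw [coeff_monomial, if_pos rfl]
    · intro α' _ h
      rw [coeff_monomial, if_neg fun h' => h (Subtype.ext (e.injective h'))]
    · exact fun h => absurd (Finset.mem_univ _) h
  refine ⟨P, ?_, fun i => ?_, ?_, ?_⟩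
  · intro h0
    refine ht0 (funext fun α => ?_)
    rw [← hcoeff, h0, coeff_zero, Pi.zero_apply]
  · refine (degreeOf_sum_le _ _ _).trans (Finset.sup_le fun α _ => ?_)
    rw [degreeOf_le_iff]
    intro β hβ
    rw [Finset.mem_singleton.1 (support_monomial_subset hβ)]
    exact (hmemS α).1 α.2 i
  · refine (length_sum_le _ _).trans ?_
    calc ∑ α : S, length (monomial (e α) (t α)) ≤ ∑ α : S, S.card * (2 * B) ^ m := by
          refine Finset.sum_le_sum fun α _ => ?_
          rw [length_monomial, Int.norm_eq_abs]
          exact htn α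
      _ = S.card * (S.card * (2 * B) ^ m) := by
          rw [Finset.sum_const, nsmul_eq_mul, Finset.card_univ, Fintype.card_coe]
      _ ≤ 2 ^ m * (2 ^ m * (2 * B) ^ m) := by gcongr
      _ = (8 * B) ^ m := by
          rw [← mul_pow, ← mul_pow]
          congr 1
          ring
  · intro β hβ
    have hsum : coeff β (translate (fun _ => ξ) (map (Int.castRingHom ℝ) P)) =
        ∑ α : S, t α * (multichoose (e α) β * ξ ^ (∑ i, e α i - ∑ i, β i)) := by
      rw [hP, map_sum, map_sum, coeff_sum]
      refine Finset.sum_congr rfl fun α _ => ?_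
      rw [map_monomial, coeff_translate_monomial, eq_intCast]
    rw [hsum]
    by_cases hβr : ∀ i, β i ≤ r i
    · have hβT : e.symm β ∈ T := Finset.mem_filter.2 ⟨(hmemS _).2 hβr, hβ⟩
      have ha' : (a : ℝ) ^ m ≠ 0 := pow_ne_zero _ (by exact_mod_cast ha)
      refine (mul_eq_zero.1 ?_).resolve_left ha'
      calc (a : ℝ) ^ m * ∑ α : S, t α * (multichoose (e α) β * ξ ^ (∑ i, e α i - ∑ i, β i))
          = ∑ α : S, ∑ k : Fin d, t α * (multichoose (e α) β *
              (c (∑ i, e α i - ∑ i, β i) k * ξ ^ (k : ℕ))) := by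
            rw [Finset.mul_sum]
            refine Finset.sum_congr rfl fun α _ => ?_
            simp only [← Finset.mul_sum]
            rw [← (hc _ ((Nat.sub_le _ _).trans (hsm α α.2))).2]
            ring
        _ = ∑ k : Fin d, ξ ^ (k : ℕ) * ((∑ α : S, (multichoose (e α) β : ℤ) *
              c (∑ i, e α i - ∑ i, β i) k * t α : ℤ) : ℝ) := by
            rw [Finset.sum_comm]
            refine Finset.sum_congr rfl fun k _ => ?_
            push_cast
            rw [Finset.mul_sum]
            exact Finset.sum_congr rfl fun α _ => by ring
        _ = 0 := by
            refine Finset.sum_eq_zero fun k _ => ?_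
            have := htA (⟨e.symm β, hβT⟩, k)
            simp only [Matrix.of_apply, Equiv.apply_symm_apply] at this
            rw [this, Int.cast_zero, mul_zero]
    · refine Finset.sum_eq_zero fun α _ => ?_
      rw [multichoose_eq_zero, Nat.cast_zero, zero_mul, mul_zero]
      exact fun h => hβr fun i => (h i).trans ((hmemS α).1 α.2 i)

lemma finite_setOf_den_le (ξ : ℝ) (N : ℕ) : {c : ℚ | |ξ - c| ≤ 1 ∧ c.den ≤ N}.Finite := by
  set M : ℕ := ⌈(|ξ| + 1) * N⌉₊ with hM
  refine Set.Finite.of_injOn (f := fun c : ℚ => (c.num, c.den))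
    (t := Set.Icc (-(M : ℤ)) M ×ˢ Set.Iic N) ?_ ?_
    ((Set.finite_Icc _ _).prod (Set.finite_Iic _))
  · rintro c ⟨h1, h2⟩
    refine ⟨?_, h2⟩
    have hc : |(c : ℝ)| ≤ |ξ| + 1 := by
      have := abs_sub_abs_le_abs_sub (c : ℝ) ξ
      rw [abs_sub_comm] at this
      linarith
    have hnum : (c.num : ℝ) = c * c.den := by
      exact_mod_cast (Rat.mul_den_eq_num c).symm
    have h3 : |(c.num : ℝ)| ≤ M := by
      rw [hnum, abs_mul, Nat.abs_cast]
      refine le_trans ?_ (Nat.le_ceil _)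
      exact mul_le_mul hc (by exact_mod_cast h2) (Nat.cast_nonneg _) (by positivity)
    rw [Set.mem_Icc, ← abs_le]
    exact_mod_cast h3
  · intro c _ c' _ h
    rw [Prod.mk.injEq] at h
    exact Rat.ext h.1 h.2

lemma exists_le_log_den {ξ : ℝ} {S : Set ℚ} (hS : S.Infinite) (hξ : ∀ c ∈ S, |ξ - (c : ℝ)| ≤ 1)
    (L : ℝ) : ∃ c ∈ S, L ≤ Real.log c.den := by
  by_contra! h
  refine hS ((finite_setOf_den_le ξ ⌈Real.exp L⌉₊).subset fun c hc => ⟨hξ c hc, ?_⟩)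
  have h1 : (0 : ℝ) < c.den := by exact_mod_cast c.den_pos
  have h2 : (c.den : ℝ) ≤ ⌈Real.exp L⌉₊ :=
    ((Real.log_lt_iff_lt_exp h1).1 (h c hc)).le.trans (Nat.le_ceil _)
  exact_mod_cast h2

lemma exists_log_den_seq {ξ : ℝ} {S : Set ℚ} (hS : S.Infinite)
    (hξ : ∀ c ∈ S, |ξ - (c : ℝ)| ≤ 1) (n : ℕ) (K L : ℝ) :
    ∃ c : Fin n → ℚ, (∀ i, c i ∈ S) ∧ (∀ i, L ≤ Real.log (c i).den) ∧
      ∀ i j, i < j → K * Real.log (c j).den ≤ Real.log (c i).den := by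
  induction n with
  | zero => exact ⟨Fin.elim0, fun i => i.elim0, fun i => i.elim0, fun i => i.elim0⟩
  | succ n ih =>
    obtain ⟨c, hcS, hcL, hcK⟩ := ih
    obtain ⟨c0, h0S, h0⟩ := exists_le_log_den hS hξ
      (max L (∑ j, |K * Real.log (c j).den|))
    refine ⟨Fin.cons c0 c, Fin.cases h0S hcS, Fin.cases ((le_max_left _ _).trans h0) hcL, ?_⟩
    refine Fin.cases (fun j => ?_) fun i j => ?_
    · refine Fin.cases (fun h => absurd h (lt_irrefl _)) (fun j _ => ?_) j
      rw [Fin.cons_zero, Fin.cons_succ]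
      refine le_trans ?_ ((le_max_right _ _).trans h0)
      exact (le_abs_self _).trans (Finset.single_le_sum
        (f := fun j => |K * Real.log (c j).den|) (fun _ _ => abs_nonneg _) (Finset.mem_univ j))
    · refine Fin.cases (fun h => absurd h (Fin.not_lt_zero _)) (fun j h => ?_) j
      rw [Fin.cons_succ, Fin.cons_succ]
      exact hcK i j (Fin.succ_lt_succ_iff.1 h)

section

variable {σ : Type*} [Fintype σ]

lemma one_le_abs_eval_mul_prod {Q : MvPolynomial σ ℤ} {r : σ → ℕ} (hr : ∀ i, degreeOf i Q ≤ r i)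
    {c : σ → ℚ} (hQ : eval c (map (Int.castRingHom ℚ) Q) ≠ 0) :
    1 ≤ |eval c (map (Int.castRingHom ℚ) Q)| * ∏ i, ((c i).den : ℚ) ^ r i := by
  obtain ⟨z, hz⟩ : ∃ z : ℤ,
      eval c (map (Int.castRingHom ℚ) Q) * ∏ i, ((c i).den : ℚ) ^ r i = z := by
    refine ⟨∑ α ∈ Q.support, coeff α Q * ∏ i, (c i).num ^ α i * ((c i).den : ℤ) ^ (r i - α i), ?_⟩
    rw [eval_map, eval₂_eq', Finset.sum_mul]
    push_cast
    refine Finset.sum_congr rfl fun α hα => ?_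
    rw [mul_assoc, ← Finset.prod_mul_distrib, eq_intCast]
    congr 1
    refine Finset.prod_congr rfl fun i _ => ?_
    have h1 : α i ≤ r i := (le_degreeOf_of_mem_support i hα).trans (hr i)
    have h2 : ((c i).num : ℚ) = c i * (c i).den := (Rat.mul_den_eq_num _).symm
    rw [h2, mul_pow, mul_assoc, ← pow_add, Nat.add_sub_cancel' h1]
  have hpos : (0 : ℚ) < ∏ i, ((c i).den : ℚ) ^ r i :=
    Finset.prod_pos fun i _ => pow_pos (by exact_mod_cast (c i).den_pos) _
  rw [← abs_of_pos hpos, ← abs_mul, hz]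
  have hz0 : z ≠ 0 := by
    rintro rfl
    rw [Int.cast_zero] at hz
    exact mul_ne_zero hQ hpos.ne' hz
  exact_mod_cast Int.one_le_abs hz0

lemma length_translate_le (ξ : ℝ) {Q : MvPolynomial σ ℤ} {r : σ → ℕ}
    (hr : ∀ i, degreeOf i Q ≤ r i) :
    length (translate (fun _ => ξ) (map (Int.castRingHom ℝ) Q)) ≤
      (1 + |ξ|) ^ (∑ i, r i) * length Q := by
  have hlin : ∀ i : σ, length (X i + C ξ : MvPolynomial σ ℝ) ≤ 1 + |ξ| := by
    intro i
    refine (length_add_le _ _).trans (add_le_add ?_ ?_)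
    · rw [X, length_monomial, norm_one]
    · rw [← monomial_zero', length_monomial, Real.norm_eq_abs]
  conv_lhs => rw [Q.as_sum]
  rw [map_sum, map_sum]
  refine (length_sum_le _ _).trans ?_
  rw [length, Finset.mul_sum]
  refine Finset.sum_le_sum fun α hα => ?_
  rw [map_monomial, translate, aeval_monomial, Finsupp.prod_fintype _ _ fun _ => pow_zero _,
    algebraMap_eq, ← monomial_zero']
  have hb : (1 : ℝ) ≤ 1 + |ξ| := le_add_of_nonneg_right (abs_nonneg _)
  calc _ ≤ length (monomial 0 ((Int.castRingHom ℝ) (coeff α Q)) : MvPolynomial σ ℝ) *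
        length (∏ i, (X i + C ξ : MvPolynomial σ ℝ) ^ α i) := length_mul_le _ _
    _ ≤ ‖coeff α Q‖ * (1 + |ξ|) ^ (∑ i, r i) := by
      rw [length_monomial]
      refine mul_le_mul (le_of_eq ?_) ?_ (length_nonneg _) (norm_nonneg _)
      · rw [eq_intCast, Int.norm_cast_real]
      · rw [← Finset.prod_pow_eq_pow_sum]
        refine (length_prod_le _ _).trans
          (Finset.prod_le_prod (fun _ _ => length_nonneg _) fun i _ => ?_)
        have h1 := length_prod_le (Finset.range (α i)) fun _ => (X i + C ξ : MvPolynomial σ ℝ)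
        rw [Finset.prod_const, Finset.prod_const, Finset.card_range] at h1
        exact h1.trans ((pow_le_pow_left₀ (length_nonneg _) (hlin i) _).trans
          (pow_le_pow_right₀ hb ((le_degreeOf_of_mem_support i hα).trans (hr i))))
    _ = _ := mul_comm _ _

lemma abs_eval_le {ξ θ B : ℝ} {r : σ → ℕ} {P : MvPolynomial σ ℝ}
    (hP : VanishesTo (fun _ => ξ) r θ P) {x : σ → ℝ}
    (hx : ∀ γ : σ →₀ ℕ, θ ≤ ∑ i, (γ i : ℝ) / r i → ∏ i, |ξ - x i| ^ γ i ≤ B) :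
    |eval x P| ≤ length (translate (fun _ => ξ) P) * B := by
  have h1 : eval x P = eval (fun i => x i - ξ) (translate (fun _ => ξ) P) := by
    rw [eval_translate]
    simp
  rw [h1, eval_eq', length, Finset.sum_mul]
  refine (Finset.abs_sum_le_sum_abs _ _).trans (Finset.sum_le_sum fun γ hγ => ?_)
  rw [abs_mul, Finset.abs_prod, Real.norm_eq_abs]
  refine mul_le_mul_of_nonneg_left ?_ (abs_nonneg _)
  simp only [abs_pow, abs_sub_comm _ ξ]
  refine hx γ (not_lt.1 fun h => ?_)
  exact mem_support_iff.1 hγ (hP γ h)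

end

lemma cast_eval_map {σ : Type*} (c : σ → ℚ) (Q : MvPolynomial σ ℤ) :
    ((eval c (map (Int.castRingHom ℚ) Q) : ℚ) : ℝ) =
      eval (fun i => (c i : ℝ)) (map (Int.castRingHom ℝ) Q) := by
  rw [eval_map, eval_map]
  change Rat.castHom ℝ _ = _
  rw [eval₂_comp_left]
  congr 1

/-- Degrees `r i` for which the numbers `r i * h i` are almost equal. -/
lemma exists_mul_mem_Icc {n : ℕ} {h : Fin n → ℝ} (hh : ∀ i, 0 < h i) {η : ℝ} (hη : 0 < η) :
    ∃ (Y : ℝ) (r : Fin n → ℕ), 0 < Y ∧ (∀ i, 0 < r i) ∧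
      ∀ i, Y ≤ r i * h i ∧ r i * h i ≤ (1 + η) * Y := by
  set Y := ∑ i, h i / η + 1 with hY
  have hnn : ∀ i, 0 ≤ h i / η := fun i => (div_pos (hh i) hη).le
  have hY0 : 0 < Y := by
    have := Finset.sum_nonneg fun i (_ : i ∈ Finset.univ) => hnn i
    linarith
  refine ⟨Y, fun i => ⌈Y / h i⌉₊, hY0, fun i => Nat.ceil_pos.2 (div_pos hY0 (hh i)), fun i => ?_⟩
  have h1 := Nat.le_ceil (Y / h i)
  have h2 := Nat.ceil_lt_add_one (div_pos hY0 (hh i)).le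
  have h3 : h i / η ≤ Y := by
    have := Finset.single_le_sum (fun i _ => hnn i) (Finset.mem_univ i)
    linarith
  rw [div_le_iff₀ hη] at h3
  refine ⟨(div_le_iff₀ (hh i)).1 h1, ?_⟩
  have h4 := mul_lt_mul_of_pos_right h2 (hh i)
  rw [add_mul, div_mul_cancel₀ _ (hh i).ne'] at h4
  linarith

theorem finite_setOf_abs_sub_le {ξ : ℝ} {f : Polynomial ℤ} (hf : f ≠ 0)
    (hξ : Polynomial.aeval ξ f = 0) {ε : ℝ} (hε : 0 < ε) :
    {c : ℚ | |ξ - (c : ℝ)| ≤ 1 / (c.den : ℝ) ^ (2 + ε)}.Finite := by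
  by_contra hS
  set S := {c : ℚ | |ξ - (c : ℝ)| ≤ 1 / (c.den : ℝ) ^ (2 + ε)} with hSdef
  have hden : ∀ c : ℚ, (1 : ℝ) ≤ c.den := fun c => by exact_mod_cast c.den_pos
  have hξS : ∀ c ∈ S, |ξ - (c : ℝ)| ≤ 1 := fun c hc =>
    hc.trans (div_le_one_of_le₀ (Real.one_le_rpow (hden c) (by linarith)) (by positivity))
  set η := ε / (16 + 4 * ε) with hη
  have hη0 : 0 < η := by positivity
  have hηε : η * (16 + 4 * ε) = ε := by
    rw [hη]
    field_simp
  have hη4 : η < 1 / 4 := by nlinarith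
  obtain ⟨n, C, hn, hC, haux⟩ := exists_vanishesTo hf hξ hη0 (by linarith)
  obtain ⟨ρ, hρ, hroth⟩ := exists_coeff_translate_ne_zero_lt n η hη0
  have hn1 : (1 : ℝ) ≤ n := by exact_mod_cast hn
  set D := (1 + |ξ|) * (2 * C) with hD
  have hCD : 2 * C ≤ D := by
    rw [hD]
    nlinarith [abs_nonneg ξ]
  have hlogD : 0 < Real.log D := Real.log_pos (by linarith)
  set Λ := 2 * n * Real.log D / min η ρ with hΛ
  have hΛ0 : 0 < Λ := div_pos (by positivity) (lt_min hη0 hρ)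
  obtain ⟨c, hcS, hcΛ, hcK⟩ := exists_log_den_seq hS hξS n (2 / ρ) Λ
  set h : Fin n → ℝ := fun i => Real.log (c i).den with hh
  have hh0 : ∀ i, 0 < h i := fun i => hΛ0.trans_le (hcΛ i)
  obtain ⟨Y, r, hY, hr, hrY⟩ := exists_mul_mem_Icc hh0 hη0
  have hr' : ∀ i, (0 : ℝ) < r i := fun i => by exact_mod_cast hr i
  have hpowden : ∀ i (x : ℝ), ((c i).den : ℝ) ^ x = Real.exp (h i * x) := fun i x =>
    Real.rpow_def_of_pos (by linarith [hden (c i)]) x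
  have hDpow : D ^ (∑ i, r i) ≤ Real.exp (min η ρ * Y) := by
    rw [← Real.exp_log (by linarith : 0 < D), ← Real.exp_nat_mul, Real.exp_le_exp]
    have h1 : ((∑ i, r i : ℕ) : ℝ) ≤ n * (2 * Y / Λ) := by
      push_cast
      calc ∑ i, (r i : ℝ) ≤ ∑ i : Fin n, 2 * Y / Λ := by
            refine Finset.sum_le_sum fun i _ => ?_
            rw [le_div_iff₀ hΛ0]
            have h2 := mul_le_mul_of_nonneg_left (hcΛ i) (hr' i).le
            have h3 := (hrY i).2
            nlinarith
        _ = _ := by simp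
    refine (mul_le_mul_of_nonneg_right h1 hlogD.le).trans_eq ?_
    have := (lt_min hη0 hρ).ne'
    rw [hΛ]
    field_simp
  obtain ⟨P, hP, hPdeg, hPlen, hPvan⟩ := haux r hr
  have hlen : 2 ^ (∑ i, r i) * length P ≤ (2 * C) ^ (∑ i, r i) := by
    rw [mul_pow]
    exact mul_le_mul_of_nonneg_left hPlen (by positivity)
  obtain ⟨μ, hμ, hμη⟩ := hroth r c P hr (fun i j hij => by
      have h1 := (hrY i).2
      have h2 := (hrY j).1
      have h3 := hcK i j hij
      rw [div_mul_eq_mul_div, div_le_iff₀ hρ] at h3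
      have h4 : (r i : ℝ) * h i ≤ 2 * (r j * h j) := by nlinarith
      have h5 : (2 * h j) * r j ≤ h i * ρ * r j := mul_le_mul_of_nonneg_right h3 (hr' j).le
      refine le_of_mul_le_mul_right ?_ (hh0 i)
      linarith) hP hPdeg (fun i => by
      refine hlen.trans ((pow_le_pow_left₀ (by linarith) hCD _).trans (hDpow.trans ?_))
      rw [hpowden, Real.exp_le_exp]
      calc min η ρ * Y ≤ ρ * Y := mul_le_mul_of_nonneg_right (min_le_right _ _) hY.le
        _ ≤ ρ * (r i * h i) := mul_le_mul_of_nonneg_left (hrY i).1 hρ.le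
        _ = _ := by ring)
  set Q := hasse μ P with hQ
  have hQdeg : ∀ i, degreeOf i Q ≤ r i := fun i => (degreeOf_hasse_le _ _ _).trans (hPdeg i)
  rw [coeff_translate, hasse_map] at hμ
  set θ := n * (1 / 2 - η) - η with hθ
  have hvan : VanishesTo (fun _ => ξ) r θ (map (Int.castRingHom ℝ) Q) := by
    rw [hQ, ← hasse_map]
    exact (hPvan.hasse μ).mono (by rw [hθ]; linarith)
  have hupper := abs_eval_le (B := Real.exp (-((2 + ε) * (θ * Y)))) hvan (x := fun i => (c i : ℝ))
    fun γ hγ => by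
      calc ∏ i, |ξ - (c i : ℝ)| ^ γ i ≤ ∏ i, Real.exp (-((2 + ε) * (γ i / r i * Y))) := by
            refine Finset.prod_le_prod (fun _ _ => by positivity) fun i _ => ?_
            have h1 : |ξ - (c i : ℝ)| ≤ Real.exp (-(h i * (2 + ε))) := by
              rw [Real.exp_neg, ← hpowden, ← one_div]
              exact hcS i
            refine (pow_le_pow_left₀ (abs_nonneg _) h1 _).trans ?_
            rw [← Real.exp_nat_mul, Real.exp_le_exp]
            have h2 : (γ i : ℝ) / r i * Y ≤ γ i * h i := by
              calc (γ i : ℝ) / r i * Y ≤ γ i / r i * (r i * h i) :=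
                    mul_le_mul_of_nonneg_left (hrY i).1 (by positivity)
                _ = γ i * h i := by
                  have := (hr' i).ne'
                  field_simp
            have h3 := mul_le_mul_of_nonneg_left h2 (by linarith : 0 ≤ 2 + ε)
            linarith
        _ = Real.exp (-((2 + ε) * ((∑ i, (γ i : ℝ) / r i) * Y))) := by
            rw [← Real.exp_sum, Finset.sum_neg_distrib, ← Finset.mul_sum, Finset.sum_mul]
        _ ≤ _ := by
            rw [Real.exp_le_exp, neg_le_neg_iff]
            exact mul_le_mul_of_nonneg_left (mul_le_mul_of_nonneg_right hγ hY.le) (by linarith)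
  have hlenQ : length (translate (fun _ => ξ) (map (Int.castRingHom ℝ) Q)) ≤
      Real.exp (η * Y) := by
    calc _ ≤ (1 + |ξ|) ^ (∑ i, r i) * length Q := length_translate_le ξ hQdeg
      _ ≤ (1 + |ξ|) ^ (∑ i, r i) * (2 * C) ^ (∑ i, r i) :=
        mul_le_mul_of_nonneg_left ((length_hasse_le μ r P hPdeg).trans hlen) (by positivity)
      _ = D ^ (∑ i, r i) := by rw [hD, mul_pow (1 + |ξ|)]
      _ ≤ Real.exp (min η ρ * Y) := hDpow
      _ ≤ Real.exp (η * Y) :=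
        Real.exp_le_exp.2 (mul_le_mul_of_nonneg_right (min_le_left _ _) hY.le)
  have hprod : ∏ i, ((c i).den : ℝ) ^ r i ≤ Real.exp (n * ((1 + η) * Y)) := by
    calc ∏ i, ((c i).den : ℝ) ^ r i ≤ ∏ i : Fin n, Real.exp ((1 + η) * Y) := by
          refine Finset.prod_le_prod (fun _ _ => by positivity) fun i _ => ?_
          rw [← Real.rpow_natCast, hpowden, Real.exp_le_exp, mul_comm]
          exact (hrY i).2
      _ = _ := by simp [Real.exp_nat_mul]
  have hlower : (1 : ℝ) ≤ |eval (fun i => (c i : ℝ)) (map (Int.castRingHom ℝ) Q)| *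
      ∏ i, ((c i).den : ℝ) ^ r i := by
    rw [← cast_eval_map]
    exact_mod_cast one_le_abs_eval_mul_prod hQdeg hμ
  have hfin : (1 : ℝ) ≤ Real.exp (η * Y + -((2 + ε) * (θ * Y)) + n * ((1 + η) * Y)) := by
    rw [Real.exp_add, Real.exp_add]
    refine hlower.trans (mul_le_mul (hupper.trans ?_) hprod (by positivity) (by positivity))
    exact mul_le_mul_of_nonneg_right hlenQ (Real.exp_pos _).le
  rw [Real.one_le_exp_iff] at hfin
  have h1 : 0 ≤ η - (2 + ε) * θ + n * (1 + η) := by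
    refine nonneg_of_mul_nonneg_left ?_ hY
    linarith
  have h2 : (n : ℝ) * (1 / 2 - 2 * η) ≤ θ := by
    rw [hθ]
    nlinarith
  have h3 := mul_le_mul_of_nonneg_left h2 (by linarith : 0 ≤ 2 + ε)
  have h4 : η ≤ n * η := le_mul_of_one_le_left hη0.le hn1
  have h5 : 0 ≤ (n : ℝ) * (6 * η + 2 * (η * ε) - ε / 2) := by linarith
  have h6 : 0 ≤ 6 * η + 2 * (η * ε) - ε / 2 := nonneg_of_mul_nonneg_right h5 (by linarith)
  linarith

end Roth

/-- (Thue–Siegel–Roth) If `ξ` is a real algebraic irrational number and `ε > 0`,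
then only finitely many rational numbers `p/q` (written with reduced denominator
`q = r.den ≥ 1`) satisfy `|ξ − p/q| ≤ 1/q^(2+ε)`. -/
theorem thue_siegel_roth (ξ : ℝ) (hξ : Irrational ξ)
    (halg : ∃ f : Polynomial ℤ, f ≠ 0 ∧ Polynomial.aeval ξ f = 0)
    (ε : ℝ) (hε : 0 < ε) :
    {r : ℚ | |ξ - (r : ℝ)| ≤ 1 / (r.den : ℝ) ^ ((2 : ℝ) + ε)}.Finite := by
  obtain ⟨f, hf, hfξ⟩ := halg
  exact Roth.finite_setOf_abs_sub_le hf hfξ hε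
end

section
/- The real number ζ(3) = Σ_{k=1}^∞ 1/k³ is an irrational number. -/
open Finset Nat in
/-- `lcm(1, …, 42N)` divides `lcm(1, …, N)` times a factorial ratio of Chebyshev type. -/
theorem lcmUpto_mul_factorial_dvd (N : ℕ) :
    lcmUpto (42 * N) * ((21 * N)! * (14 * N)! * (6 * N)! * N !) ∣ lcmUpto N * (42 * N)! := by
  have h1 := lcmUpto_ne_zero
  have h2 := factorial_ne_zero
  rw [← factorization_prime_le_iff_dvd (by simp [h1, h2]) (by simp [h1, h2])]
  intro p hp
  set b := Nat.log p (42 * N) + 1 with hb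
  have hlog (M : ℕ) (hM : M ≤ 42 * N) : Nat.log p M < b :=
    Nat.lt_succ_of_le (Nat.log_mono_right hM)
  have hcard (M : ℕ) (hM : M ≤ 42 * N) :
      Nat.log p M = ∑ i ∈ Ico 1 b, if p ^ i ≤ M then 1 else 0 := by
    rw [← card_filter]
    have : (Ico 1 b).filter (fun i ↦ p ^ i ≤ M) = Ico 1 (Nat.log p M + 1) := by
      ext i
      simp only [mem_filter, mem_Ico]
      constructor
      · rintro ⟨⟨hi, -⟩, h⟩
        exact ⟨hi, Nat.lt_succ_of_le (Nat.le_log_of_pow_le hp.one_lt h)⟩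
      · rintro ⟨hi, h⟩
        have hM0 : M ≠ 0 := by
          rintro rfl
          simp at h
          omega
        exact ⟨⟨hi, by have := hlog M hM; omega⟩, Nat.pow_le_of_le_log hM0 (by omega)⟩
    rw [this]; simp
  simp only [factorization_mul, h1, h2, ne_eq, mul_eq_zero, or_self, not_false_eq_true,
    Finsupp.add_apply]
  rw [factorization_lcmUpto _ hp, factorization_lcmUpto _ hp, hcard _ le_rfl,
    hcard N (by omega), factorization_factorial hp (hlog _ le_rfl),
    factorization_factorial hp (hlog (21 * N) (by omega)),
    factorization_factorial hp (hlog (14 * N) (by omega)),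
    factorization_factorial hp (hlog (6 * N) (by omega)),
    factorization_factorial hp (hlog N (by omega)),
    ← sum_add_distrib, ← sum_add_distrib, ← sum_add_distrib, ← sum_add_distrib,
    ← sum_add_distrib]
  refine sum_le_sum fun i _ ↦ ?_
  have hM : 0 < p ^ i := pow_pos hp.pos _
  generalize p ^ i = M at hM
  have e1 : 21 * N / M * M ≤ 21 * N := Nat.div_mul_le_self _ _
  have e2 : 14 * N / M * M ≤ 14 * N := Nat.div_mul_le_self _ _
  have e3 : 6 * N / M * M ≤ 6 * N := Nat.div_mul_le_self _ _
  have e4 : N / M * M ≤ N := Nat.div_mul_le_self _ _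
  by_cases hN : M ≤ N
  · rw [if_pos hN, if_pos (by omega)]
    have : 21 * N / M + 14 * N / M + 6 * N / M + N / M ≤ 42 * N / M := by
      rw [Nat.le_div_iff_mul_le hM]
      simp only [add_mul]; omega
    omega
  · rw [if_neg hN]
    have h0 : N / M = 0 := Nat.div_eq_of_lt (by omega)
    by_cases hN' : M ≤ 42 * N
    · rw [if_pos hN', h0]
      have g1 : 1 ≤ 42 * N / M := (Nat.le_div_iff_mul_le hM).2 (by omega)
      have g2 : 2 * (21 * N / M) ≤ 42 * N / M := by
        rw [Nat.le_div_iff_mul_le hM]; rw [mul_assoc]; omega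
      have g3 : 3 * (14 * N / M) ≤ 42 * N / M := by
        rw [Nat.le_div_iff_mul_le hM]; rw [mul_assoc]; omega
      have g4 : 7 * (6 * N / M) ≤ 42 * N / M := by
        rw [Nat.le_div_iff_mul_le hM]; rw [mul_assoc]; omega
      omega
    · rw [if_neg hN']
      have : 42 * N / M = 0 := Nat.div_eq_of_lt (by omega)
      have : 21 * N / M = 0 := Nat.div_eq_of_lt (by omega)
      have : 14 * N / M = 0 := Nat.div_eq_of_lt (by omega)
      have : 6 * N / M = 0 := Nat.div_eq_of_lt (by omega)
      omega

open Nat in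
/-- A single term of the binomial expansion of `(x + y) ^ (a + b)` bounds the factorial of
`a + b`. -/
theorem factorial_add_mul_pow_le (a b x y : ℕ) :
    (a + b)! * (x ^ a * y ^ b) ≤ (x + y) ^ (a + b) * (a ! * b !) := by
  have h : x ^ a * y ^ b * (a + b).choose a ≤ (x + y) ^ (a + b) := by
    rw [add_pow]
    have := Finset.single_le_sum
      (f := fun m ↦ x ^ m * y ^ (a + b - m) * (a + b).choose m)
      (fun i _ ↦ Nat.zero_le _) (Finset.mem_range.2 (show a < a + b + 1 by omega))
    simpa using this
  rw [← Nat.add_choose_mul_factorial_mul_factorial a b, ← Nat.choose_symm_add]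
  calc _ = x ^ a * y ^ b * (a + b).choose a * (a ! * b !) := by ring
    _ ≤ _ := Nat.mul_le_mul_right _ h

open Nat in
theorem factorial_forty_two_mul_le (N : ℕ) :
    (42 * N)! ≤ 2 ^ (66 * N) * ((21 * N)! * (14 * N)! * (6 * N)! * N !) := by
  have h1 := factorial_add_mul_pow_le (21 * N) (21 * N) 1 1
  have h2 := factorial_add_mul_pow_le (14 * N) (7 * N) 2 1
  have h3 := factorial_add_mul_pow_le (6 * N) N 6 1
  rw [show 21 * N + 21 * N = 42 * N by ring] at h1
  rw [show 14 * N + 7 * N = 21 * N by ring] at h2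
  rw [show 6 * N + N = 7 * N by ring] at h3
  norm_num at h1 h2 h3
  have h4 : 3 ^ (21 * N) * 7 ^ (7 * N) ≤ 2 ^ (24 * N) * (2 ^ (14 * N) * 6 ^ (6 * N)) := by
    simp only [pow_mul, ← mul_pow]
    exact Nat.pow_le_pow_left (by norm_num) N
  have hpos : 0 < 2 ^ (14 * N) * 6 ^ (6 * N) := by positivity
  refine Nat.le_of_mul_le_mul_right ?_ hpos
  calc (42 * N)! * (2 ^ (14 * N) * 6 ^ (6 * N))
      ≤ 2 ^ (42 * N) * ((21 * N)! * (21 * N)!) * (2 ^ (14 * N) * 6 ^ (6 * N)) := by gcongr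
    _ = 2 ^ (42 * N) * (21 * N)! * ((21 * N)! * 2 ^ (14 * N)) * 6 ^ (6 * N) := by ring
    _ ≤ 2 ^ (42 * N) * (21 * N)! * (3 ^ (21 * N) * ((14 * N)! * (7 * N)!)) * 6 ^ (6 * N) := by
        gcongr
    _ = 2 ^ (42 * N) * (21 * N)! * 3 ^ (21 * N) * (14 * N)! * ((7 * N)! * 6 ^ (6 * N)) := by ring
    _ ≤ 2 ^ (42 * N) * (21 * N)! * 3 ^ (21 * N) * (14 * N)!
          * (7 ^ (7 * N) * ((6 * N)! * N !)) := by gcongr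
    _ = 2 ^ (42 * N) * ((21 * N)! * (14 * N)! * (6 * N)! * N !)
          * (3 ^ (21 * N) * 7 ^ (7 * N)) := by ring
    _ ≤ 2 ^ (42 * N) * ((21 * N)! * (14 * N)! * (6 * N)! * N !)
          * (2 ^ (24 * N) * (2 ^ (14 * N) * 6 ^ (6 * N))) := by gcongr
    _ = _ := by
        rw [show 66 * N = 42 * N + 24 * N by ring, pow_add]; ring

open Nat in
theorem lcmUpto_forty_two_mul_le (N : ℕ) : lcmUpto (42 * N) ≤ 2 ^ (66 * N) * lcmUpto N := by
  have hpos : 0 < (21 * N)! * (14 * N)! * (6 * N)! * N ! := by positivity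
  refine Nat.le_of_mul_le_mul_right ?_ hpos
  calc _ ≤ lcmUpto N * (42 * N)! :=
        Nat.le_of_dvd (Nat.mul_pos (lcmUpto_pos N) (factorial_pos _)) (lcmUpto_mul_factorial_dvd N)
    _ ≤ lcmUpto N * (2 ^ (66 * N) * ((21 * N)! * (14 * N)! * (6 * N)! * N !)) :=
        Nat.mul_le_mul_left _ (factorial_forty_two_mul_le N)
    _ = _ := by ring

open Nat in
theorem lcmUpto_le_two_pow (N : ℕ) : lcmUpto N ≤ 2 ^ (9 * N) := by
  have h := Chebyshev.psi_le_const_mul_self (x := N) (by positivity)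
  rw [Chebyshev.psi_eq_log_lcmUpto] at h
  have h2 : Real.log 4 = 2 * Real.log 2 := by
    rw [show (4 : ℝ) = 2 ^ 2 by norm_num, Real.log_pow]; norm_num
  have h3 := Real.log_two_gt_d9
  have h4 : Real.log (lcmUpto N) ≤ Real.log ((2 : ℝ) ^ (9 * N)) := by
    rw [Real.log_pow]
    push_cast
    have : (0 : ℝ) ≤ N := by positivity
    nlinarith
  have h5 := (Real.log_le_log_iff (by exact_mod_cast lcmUpto_pos N) (by positivity)).1 h4
  exact_mod_cast h5

open Nat in
theorem lcmUpto_cube_le (N : ℕ) : lcmUpto (1764 * N) ^ 3 ≤ 2 ^ (8541 * N) := by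
  have h1 := lcmUpto_forty_two_mul_le (42 * N)
  have h2 := lcmUpto_forty_two_mul_le N
  have h3 := lcmUpto_le_two_pow N
  rw [← mul_assoc] at h1
  norm_num at h1
  calc lcmUpto (1764 * N) ^ 3
      ≤ (2 ^ (66 * (42 * N)) * (2 ^ (66 * N) * 2 ^ (9 * N))) ^ 3 := by
        gcongr
        exact h1.trans (Nat.mul_le_mul_left _ (h2.trans (Nat.mul_le_mul_left _ h3)))
    _ = _ := by
        rw [← pow_add, ← pow_add, ← pow_mul]; congr 1; ring

/-- The product `C(n, k) C(n + k, k)`. -/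
noncomputable def aperyCoeff (n k : ℕ) : ℝ := n.choose k * (n + k).choose k

/-- The coefficients `c(n, k)` of Apéry's second sequence. -/
noncomputable def aperyC (n k : ℕ) : ℝ :=
  ∑ m ∈ Finset.range n, 1 / ((m : ℝ) + 1) ^ 3 +
    ∑ m ∈ Finset.range k, (-1) ^ m / (2 * ((m : ℝ) + 1) ^ 3 * aperyCoeff n (m + 1))

/-- The Apéry numbers. -/
noncomputable def aperyA (n : ℕ) : ℝ := ∑ k ∈ Finset.range (n + 1), aperyCoeff n k ^ 2

/-- The numerators of the Apéry approximations to `ζ(3)`. -/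
noncomputable def aperyB (n : ℕ) : ℝ :=
  ∑ k ∈ Finset.range (n + 1), aperyCoeff n k ^ 2 * aperyC n k

theorem aperyCoeff_zero_right (n : ℕ) : aperyCoeff n 0 = 1 := by simp [aperyCoeff]

theorem aperyCoeff_eq_zero {n k : ℕ} (h : n < k) : aperyCoeff n k = 0 := by
  simp [aperyCoeff, Nat.choose_eq_zero_of_lt h]

theorem aperyCoeff_pos {n k : ℕ} (h : k ≤ n) : 0 < aperyCoeff n k := by
  have h1 := Nat.choose_pos h
  have h2 := Nat.choose_pos (show k ≤ n + k by omega)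
  unfold aperyCoeff
  positivity

theorem aperyCoeff_nonneg (n k : ℕ) : 0 ≤ aperyCoeff n k := by
  unfold aperyCoeff; positivity

theorem choose_succ_left_mul (n k : ℕ) :
    ((n + 1).choose k : ℝ) * ((n : ℝ) + 1 - k) = n.choose k * ((n : ℝ) + 1) := by
  rcases le_or_gt k (n + 1) with h | h
  · have := Nat.choose_mul_succ_eq n k
    have h2 : (((n + 1 - k : ℕ)) : ℝ) = (n : ℝ) + 1 - k := by
      rw [Nat.cast_sub h]; push_cast; ring
    rw [← h2]
    exact_mod_cast this.symm
  · rw [Nat.choose_eq_zero_of_lt h, Nat.choose_eq_zero_of_lt (by omega)]; simp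

theorem choose_succ_succ_mul (n k : ℕ) :
    ((n + 1).choose (k + 1) : ℝ) * ((k : ℝ) + 1) = n.choose k * ((n : ℝ) + 1) := by
  have := Nat.add_one_mul_choose_eq n k
  rw [mul_comm] at this
  exact_mod_cast this.symm

theorem aperyCoeff_succ_left (n k : ℕ) :
    aperyCoeff (n + 1) k * ((n : ℝ) + 1 - k) = aperyCoeff n k * ((n : ℝ) + 1 + k) := by
  have h1 := choose_succ_left_mul n k
  have h2 := choose_succ_left_mul (n + k) k
  push_cast at h2
  rw [show n + k + 1 = n + 1 + k by ring] at h2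
  have h3 : (n : ℝ) + 1 ≠ 0 := by positivity
  unfold aperyCoeff
  apply mul_right_cancel₀ h3
  linear_combination ((n + 1 + k).choose k : ℝ) * ((n : ℝ) + 1) * h1 +
    (n.choose k : ℝ) * ((n : ℝ) + 1) * h2

theorem aperyCoeff_succ_succ (n k : ℕ) :
    aperyCoeff (n + 1) (k + 1) * ((k : ℝ) + 1) ^ 2 =
      aperyCoeff n k * ((n : ℝ) + k + 1) * ((n : ℝ) + k + 2) := by
  have h1 := choose_succ_succ_mul n k
  have h2 := choose_succ_succ_mul (n + k + 1) k
  have h4 := choose_succ_left_mul (n + k) k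
  push_cast at h2 h4
  rw [show n + k + 1 + 1 = n + 1 + (k + 1) by ring] at h2
  unfold aperyCoeff
  linear_combination ((n + 1 + (k + 1)).choose (k + 1) : ℝ) * ((k : ℝ) + 1) * h1 +
    (n.choose k : ℝ) * ((n : ℝ) + 1) * h2 +
    (n.choose k : ℝ) * ((n : ℝ) + k + 2) * h4

theorem aperyCoeff_succ_right (n k : ℕ) :
    aperyCoeff n (k + 1) * ((k : ℝ) + 1) ^ 2 =
      aperyCoeff n k * ((n : ℝ) - k) * ((n : ℝ) + k + 1) := by
  have h1 := aperyCoeff_succ_left n (k + 1)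
  have h2 := aperyCoeff_succ_succ n k
  push_cast at h1
  have h3 : (n : ℝ) + k + 2 ≠ 0 := by positivity
  apply mul_right_cancel₀ h3
  linear_combination -((k : ℝ) + 1) ^ 2 * h1 + ((n : ℝ) - k) * h2

/-- All neighbouring coefficients are polynomial multiples of a common quantity. -/
theorem exists_aperyCoeff_eq (n k : ℕ) : ∃ t : ℝ,
    aperyCoeff n k = t * ((n : ℝ) + 1 - k) * ((n : ℝ) + 2 - k) ∧
    aperyCoeff (n + 1) k = t * ((n : ℝ) + 1 + k) * ((n : ℝ) + 2 - k) ∧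
    aperyCoeff (n + 2) k = t * ((n : ℝ) + 1 + k) * ((n : ℝ) + 2 + k) ∧
    ∀ j, k = j + 1 → aperyCoeff (n + 1) j = t * (k : ℝ) ^ 2 := by
  have hA : (n : ℝ) + 1 + k ≠ 0 := by positivity
  have hB : (n : ℝ) + 2 + k ≠ 0 := by positivity
  have h1 := aperyCoeff_succ_left n k
  have h2 := aperyCoeff_succ_left (n + 1) k
  push_cast at h2
  have e2 : aperyCoeff (n + 2) k = aperyCoeff (n + 2) k / (((n : ℝ) + 1 + k) * ((n : ℝ) + 2 + k)) *
      ((n : ℝ) + 1 + k) * ((n : ℝ) + 2 + k) := by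
    field_simp
  generalize aperyCoeff (n + 2) k / (((n : ℝ) + 1 + k) * ((n : ℝ) + 2 + k)) = t at e2
  have e1 : aperyCoeff (n + 1) k = t * ((n : ℝ) + 1 + k) * ((n : ℝ) + 2 - k) := by
    apply mul_right_cancel₀ hB
    rw [e2] at h2
    linear_combination -h2
  refine ⟨t, ?_, e1, e2, ?_⟩
  · apply mul_right_cancel₀ hA
    rw [e1] at h1
    linear_combination -h1
  · rintro j rfl
    have h3 := aperyCoeff_succ_succ (n + 1) j
    rw [e2] at h3
    push_cast at h3 hA hB ⊢
    have hC : ((n : ℝ) + 1 + j + 1) * ((n : ℝ) + 1 + j + 2) ≠ 0 := by positivity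
    apply mul_right_cancel₀ hC
    linear_combination -h3

/-- The polynomial certificate for the telescoping of Apéry's recurrence. -/
noncomputable def aperyCert (n k : ℕ) : ℝ :=
  4 * (2 * (n : ℝ) + 3) * (k * (2 * k + 1) - (2 * (n : ℝ) + 3) ^ 2) * aperyCoeff (n + 1) k ^ 2

/-- The middle coefficient of Apéry's recurrence. -/
noncomputable def aperyP (x : ℝ) : ℝ := 34 * x ^ 3 + 51 * x ^ 2 + 27 * x + 5

theorem sum_aperyA_recurrence (n K : ℕ) :
    ∑ k ∈ Finset.range (K + 1), (((n : ℝ) + 2) ^ 3 * aperyCoeff (n + 2) k ^ 2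
      - aperyP (n + 1) * aperyCoeff (n + 1) k ^ 2
      + ((n : ℝ) + 1) ^ 3 * aperyCoeff n k ^ 2) = aperyCert n K := by
  induction K with
  | zero =>
    simp only [zero_add, Finset.sum_range_one, aperyCoeff_zero_right, aperyCert, aperyP]
    push_cast; ring
  | succ K ih =>
    rw [Finset.sum_range_succ, ih]
    obtain ⟨t, h0, h1, h2, h3⟩ := exists_aperyCoeff_eq n (K + 1)
    unfold aperyCert
    rw [h0, h1, h2, h3 K rfl]
    unfold aperyP
    push_cast; ring

theorem aperyA_eq_sum {n N : ℕ} (h : n < N) :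
    aperyA n = ∑ k ∈ Finset.range N, aperyCoeff n k ^ 2 := by
  apply Finset.sum_subset (Finset.range_subset_range.2 h)
  intro k _ hk
  rw [aperyCoeff_eq_zero (by simpa using hk)]; simp

theorem aperyB_eq_sum {n N : ℕ} (h : n < N) :
    aperyB n = ∑ k ∈ Finset.range N, aperyCoeff n k ^ 2 * aperyC n k := by
  apply Finset.sum_subset (Finset.range_subset_range.2 h)
  intro k _ hk
  rw [aperyCoeff_eq_zero (by simpa using hk)]; simp

theorem aperyA_recurrence (n : ℕ) :
    ((n : ℝ) + 2) ^ 3 * aperyA (n + 2) - aperyP (n + 1) * aperyA (n + 1)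
      + ((n : ℝ) + 1) ^ 3 * aperyA n = 0 := by
  have h := sum_aperyA_recurrence n (n + 2)
  rw [aperyCert, aperyCoeff_eq_zero (show n + 1 < n + 2 by omega), Finset.sum_add_distrib,
    Finset.sum_sub_distrib, ← Finset.mul_sum, ← Finset.mul_sum, ← Finset.mul_sum,
    ← aperyA_eq_sum (by omega), ← aperyA_eq_sum (by omega), ← aperyA_eq_sum (by omega)] at h
  rw [h]; simp

theorem aperyC_succ_right (n k : ℕ) :
    aperyC n (k + 1) =
      aperyC n k + (-1) ^ k / (2 * ((k : ℝ) + 1) ^ 3 * aperyCoeff n (k + 1)) := by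
  unfold aperyC
  rw [Finset.sum_range_succ]; ring

theorem aperyC_succ_left {n k : ℕ} (h : k ≤ n) :
    aperyC (n + 1) k = aperyC n k +
      (-1) ^ k / (((n : ℝ) + 1) ^ 2 * ((n : ℝ) + 1 - k) * aperyCoeff (n + 1) k) := by
  induction k with
  | zero =>
    simp only [aperyC, Finset.sum_range_succ, aperyCoeff_zero_right, Finset.range_zero,
      Finset.sum_empty]
    push_cast
    field_simp
    ring
  | succ k ih =>
    rw [aperyC_succ_right, aperyC_succ_right, ih (by omega)]
    have hk : (k : ℝ) + 1 ≤ n := by exact_mod_cast h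
    have q1 : (n : ℝ) - k ≠ 0 := by linarith
    have q2 : (n : ℝ) + 1 - k ≠ 0 := by linarith
    have q3 : (n : ℝ) + k + 2 ≠ 0 := by positivity
    have q4 : (k : ℝ) + 1 ≠ 0 := by positivity
    have q5 : (n : ℝ) + 1 ≠ 0 := by positivity
    have p1 := (aperyCoeff_pos (show k ≤ n + 1 by omega)).ne'
    have h1 := aperyCoeff_succ_left n (k + 1)
    have h2 := aperyCoeff_succ_right (n + 1) k
    push_cast at h1 h2 ⊢
    have e2 : aperyCoeff (n + 1) (k + 1) =
        aperyCoeff (n + 1) k * ((n : ℝ) + 1 - k) * ((n : ℝ) + k + 2) / ((k : ℝ) + 1) ^ 2 := by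
      rw [eq_div_iff (by positivity)]; linear_combination h2
    have e1 : aperyCoeff n (k + 1) =
        aperyCoeff (n + 1) k * ((n : ℝ) + 1 - k) * ((n : ℝ) - k) / ((k : ℝ) + 1) ^ 2 := by
      rw [e2] at h1
      rw [eq_div_iff (by positivity)]
      apply mul_right_cancel₀ q3
      field_simp at h1
      linear_combination -h1
    rw [e1, e2]
    have q6 : (n : ℝ) + 1 - (k + 1) ≠ 0 := by
      contrapose! q1; linarith
    rw [pow_succ (-1 : ℝ) k]
    field_simp
    ring

/-- The full certificate for the second sequence. -/
noncomputable def aperyCertB (n k : ℕ) : ℝ :=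
  aperyCert n k * aperyC (n + 1) k
    - 5 * (2 * (n : ℝ) + 3) * (-1) ^ k * k / (((n : ℝ) + 1) * (n + 2)) * aperyCoeff (n + 1) k

theorem aperyCoeff_sq_mul_aperyC (n k : ℕ) :
    aperyCoeff n k ^ 2 * aperyC n k = aperyCoeff n k ^ 2 * aperyC (n + 1) k
      - (-1) ^ k * aperyCoeff n k / (((n : ℝ) + 1) ^ 2 * ((n : ℝ) + 1 + k)) := by
  rcases Nat.lt_or_ge n k with hk | hk
  · rw [aperyCoeff_eq_zero hk]; simp
  · rw [aperyC_succ_left hk]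
    have hk' : (k : ℝ) ≤ n := by exact_mod_cast hk
    have q2 : (n : ℝ) + 1 - k ≠ 0 := by linarith
    have p0 := (aperyCoeff_pos hk).ne'
    have q3 : (n : ℝ) + 1 + k ≠ 0 := by positivity
    have e : aperyCoeff (n + 1) k = aperyCoeff n k * ((n : ℝ) + 1 + k) / ((n : ℝ) + 1 - k) := by
      rw [eq_div_iff q2, aperyCoeff_succ_left]
    rw [e]
    field_simp
    ring

theorem sum_aperyB_recurrence (n K : ℕ) (hK : K ≤ n + 2) :
    ∑ k ∈ Finset.range (K + 1), (((n : ℝ) + 2) ^ 3 * (aperyCoeff (n + 2) k ^ 2 * aperyC (n + 2) k)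
      - aperyP (n + 1) * (aperyCoeff (n + 1) k ^ 2 * aperyC (n + 1) k)
      + ((n : ℝ) + 1) ^ 3 * (aperyCoeff n k ^ 2 * aperyC n k)) = aperyCertB n K := by
  induction K with
  | zero =>
    simp only [zero_add, aperyCoeff_zero_right, aperyCertB, aperyCert,
      aperyP, aperyC, Finset.sum_range_succ, Finset.range_zero, Finset.sum_empty]
    push_cast
    field_simp
    ring
  | succ K ih =>
    rw [Finset.sum_range_succ, ih (by omega)]
    obtain ⟨t, h0, h1, h2, h3⟩ := exists_aperyCoeff_eq n (K + 1)
    have h3 := h3 K rfl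
    have q0 : (n : ℝ) + 1 ≠ 0 := by positivity
    have q1 : (n : ℝ) + 2 ≠ 0 := by positivity
    have q4 : (K : ℝ) + 1 ≠ 0 := by positivity
    rcases Nat.lt_or_ge K (n + 1) with hlt | hge
    · have hc2 := aperyC_succ_left (show K + 1 ≤ n + 1 by omega)
      have hc1 := aperyC_succ_right (n + 1) K
      have hlt' : (K : ℝ) + 1 ≤ n + 1 := by exact_mod_cast hlt
      have q2 : (n : ℝ) + 1 - K ≠ 0 := by linarith
      have q3 : (n : ℝ) + 1 + (K + 1) ≠ 0 := by positivity
      have q5 : (n : ℝ) + 2 + (K + 1) ≠ 0 := by positivity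
      have ht : t ≠ 0 := by
        rintro rfl
        have := aperyCoeff_pos (show K + 1 ≤ n + 1 by omega)
        rw [h1] at this; simp at this
      rw [aperyCoeff_sq_mul_aperyC n (K + 1), hc2]
      unfold aperyCertB aperyCert
      rw [show aperyC (n + 1) K = aperyC (n + 1) (K + 1) -
        (-1) ^ K / (2 * ((K : ℝ) + 1) ^ 3 * aperyCoeff (n + 1) (K + 1)) by rw [hc1]; ring]
      generalize aperyC (n + 1) (K + 1) = C
      rw [h0, h1, h2, h3, pow_succ (-1 : ℝ) K]
      generalize (-1 : ℝ) ^ K = s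
      unfold aperyP
      push_cast
      rw [show (n : ℝ) + 1 + 1 - (K + 1) = n + 1 - K by ring,
        show (n : ℝ) + 2 - (K + 1) = n + 1 - K by ring, show (n : ℝ) + 1 + 1 = n + 2 by ring]
      generalize (n : ℝ) = x at *
      generalize (K : ℝ) = y at *
      clear * - q0 q1 q2 q3 q4 q5 ht
      obtain ⟨d, rfl⟩ : ∃ d, x = d + y - 1 := ⟨x + 1 - y, by ring⟩
      rw [show d + y - 1 + 1 - y = d by ring] at *
      field_simp
      ring
    · obtain rfl : K = n + 1 := by omega
      have hc2 := aperyC_succ_left (le_refl (n + 1))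
      have hc3 := aperyC_succ_right (n + 2) (n + 1)
      have h4 := aperyCoeff_succ_left (n + 1) (n + 1)
      push_cast at h1 h2 h3 h4 hc2 hc3
      have ht : t ≠ 0 := by
        rintro rfl
        have := aperyCoeff_pos (le_refl (n + 1))
        rw [h3] at this; simp at this
      have h4' : aperyCoeff (n + 2) (n + 1) = t * ((n : ℝ) + 2) ^ 2 * (2 * n + 3) := by
        rw [h3] at h4; linear_combination h4
      have h2' : aperyCoeff (n + 2) (n + 2) = t * (2 * n + 3) * (2 * n + 4) := by
        rw [h2]; ring
      have q8 : 2 * (n : ℝ) + 3 ≠ 0 := by positivity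
      have q9 : 2 * (n : ℝ) + 4 ≠ 0 := by positivity
      have e1 : aperyCoeff (n + 1) (n + 1 + 1) = 0 := aperyCoeff_eq_zero (by omega)
      have e0 : aperyCoeff n (n + 1 + 1) = 0 := aperyCoeff_eq_zero (by omega)
      unfold aperyCertB aperyCert
      rw [e1, e0, hc3, hc2, h3, h2', h4']
      generalize aperyC (n + 1) (n + 1) = C
      generalize (-1 : ℝ) ^ (n + 1) = s
      rw [show (n : ℝ) + 1 + 1 - (n + 1) = 1 by ring]
      push_cast
      field_simp
      ring

theorem aperyB_recurrence (n : ℕ) :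
    ((n : ℝ) + 2) ^ 3 * aperyB (n + 2) - aperyP (n + 1) * aperyB (n + 1)
      + ((n : ℝ) + 1) ^ 3 * aperyB n = 0 := by
  have h := sum_aperyB_recurrence n (n + 2) le_rfl
  rw [aperyCertB, aperyCert, aperyCoeff_eq_zero (show n + 1 < n + 2 by omega),
    Finset.sum_add_distrib,
    Finset.sum_sub_distrib, ← Finset.mul_sum, ← Finset.mul_sum, ← Finset.mul_sum,
    ← aperyB_eq_sum (by omega), ← aperyB_eq_sum (by omega), ← aperyB_eq_sum (by omega)] at h
  rw [h]; simp

theorem aperyA_zero : aperyA 0 = 1 := by simp [aperyA, aperyCoeff]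

theorem aperyA_one : aperyA 1 = 5 := by
  norm_num [aperyA, aperyCoeff, Finset.sum_range_succ, Nat.choose]

theorem aperyB_zero : aperyB 0 = 0 := by simp [aperyB, aperyC]

theorem aperyB_one : aperyB 1 = 6 := by
  norm_num [aperyB, aperyC, aperyCoeff, Finset.sum_range_succ, Nat.choose]

theorem apery_casoratian (n : ℕ) :
    aperyB (n + 1) * aperyA n - aperyA (n + 1) * aperyB n = 6 / ((n : ℝ) + 1) ^ 3 := by
  induction n with
  | zero => simp [aperyA_zero, aperyA_one, aperyB_zero, aperyB_one]
  | succ n ih =>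
    have hA := aperyA_recurrence n
    have hB := aperyB_recurrence n
    rw [eq_div_iff (by positivity)] at ih ⊢
    push_cast
    linear_combination aperyA (n + 1) * hB - aperyB (n + 1) * hA + ih

theorem one_le_aperyA (n : ℕ) : 1 ≤ aperyA n := by
  unfold aperyA
  rw [Finset.sum_range_succ']
  simp only [aperyCoeff_zero_right, one_pow, le_add_iff_nonneg_left]
  positivity

theorem aperyA_pos (n : ℕ) : 0 < aperyA n := one_pos.trans_le (one_le_aperyA n)

theorem aperyA_le_succ (n : ℕ) : aperyA n ≤ aperyA (n + 1) := by
  rw [aperyA_eq_sum (show n < n + 2 by omega), aperyA]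
  refine Finset.sum_le_sum fun k _ ↦ pow_le_pow_left₀ (aperyCoeff_nonneg n k) ?_ 2
  unfold aperyCoeff
  have h1 := Nat.choose_le_choose k (show n ≤ n + 1 by omega)
  have h2 := Nat.choose_le_choose k (show n + k ≤ n + 1 + k by omega)
  exact_mod_cast Nat.mul_le_mul h1 h2

theorem mul_aperyA_le (n : ℕ) :
    (aperyP (n + 1) - ((n : ℝ) + 1) ^ 3) * aperyA (n + 1) ≤
      ((n : ℝ) + 2) ^ 3 * aperyA (n + 2) := by
  have h := aperyA_recurrence n
  have h1 : ((n : ℝ) + 1) ^ 3 * aperyA n ≤ ((n : ℝ) + 1) ^ 3 * aperyA (n + 1) :=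
    mul_le_mul_of_nonneg_left (aperyA_le_succ n) (by positivity)
  linarith

theorem two_mul_aperyA_le (n : ℕ) : 2 * aperyA n ≤ aperyA (n + 1) := by
  cases n with
  | zero => rw [aperyA_zero, aperyA_one]; norm_num
  | succ n =>
    have h := mul_aperyA_le n
    have hp := aperyA_pos (n + 1)
    have h2 : 2 * ((n : ℝ) + 2) ^ 3 ≤ aperyP (n + 1) - ((n : ℝ) + 1) ^ 3 := by
      unfold aperyP
      have : (0 : ℝ) ≤ n := by positivity
      have : (0 : ℝ) ≤ n ^ 2 := by positivity
      have : (0 : ℝ) ≤ n ^ 3 := by positivity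
      nlinarith
    have h3 := mul_le_mul_of_nonneg_right h2 hp.le
    have h4 : (0 : ℝ) < ((n : ℝ) + 2) ^ 3 := by positivity
    refine le_of_mul_le_mul_left ?_ h4
    linarith

theorem thirty_two_mul_aperyA_le {n : ℕ} (hn : 47 ≤ n) : 32 * aperyA n ≤ aperyA (n + 1) := by
  obtain ⟨m, rfl⟩ : ∃ m, n = m + 47 := ⟨n - 47, by omega⟩
  have h := mul_aperyA_le (m + 46)
  have hp := aperyA_pos (m + 47)
  have h2 : 32 * (((m + 46 : ℕ) : ℝ) + 2) ^ 3 ≤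
      aperyP ((m + 46 : ℕ) + 1) - (((m + 46 : ℕ) : ℝ) + 1) ^ 3 := by
    unfold aperyP
    push_cast
    have : (0 : ℝ) ≤ m := by positivity
    have : (0 : ℝ) ≤ m ^ 2 := by positivity
    have : (0 : ℝ) ≤ m ^ 3 := by positivity
    nlinarith
  have h3 := mul_le_mul_of_nonneg_right h2 hp.le
  have h4 : (0 : ℝ) < (((m + 46 : ℕ) : ℝ) + 2) ^ 3 := by positivity
  refine le_of_mul_le_mul_left ?_ h4
  linarith

theorem two_pow_le_aperyA (n : ℕ) : (2 : ℝ) ^ (5 * n) ≤ 2 ^ 235 * aperyA n := by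
  rcases le_or_gt n 47 with h | h
  · calc (2 : ℝ) ^ (5 * n) ≤ 2 ^ 235 := pow_le_pow_right₀ (by norm_num) (by omega)
      _ ≤ _ := le_mul_of_one_le_right (by positivity) (one_le_aperyA n)
  · induction n, h.le using Nat.le_induction with
    | base => omega
    | succ n hn ih =>
      have h1 := thirty_two_mul_aperyA_le hn
      have h2 : (2 : ℝ) ^ (5 * n) ≤ 2 ^ 235 * aperyA n := by
        rcases hn.eq_or_lt with rfl | hlt
        · exact le_mul_of_one_le_right (by positivity) (one_le_aperyA 47)
        · exact ih hlt
      calc (2 : ℝ) ^ (5 * (n + 1)) = 32 * 2 ^ (5 * n) := by rw [mul_add, pow_add]; norm_num; ring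
        _ ≤ 32 * (2 ^ 235 * aperyA n) := by gcongr
        _ = 2 ^ 235 * (32 * aperyA n) := by ring
        _ ≤ _ := by gcongr

open Filter Topology

theorem hasSum_zeta_three :
    HasSum (fun m : ℕ ↦ 1 / ((m : ℝ) + 1) ^ 3) (∑' k : ℕ, 1 / (k : ℝ) ^ 3) := by
  have h : Summable fun k : ℕ ↦ 1 / (k : ℝ) ^ 3 :=
    Real.summable_one_div_nat_pow.2 (by norm_num)
  have h2 := (hasSum_nat_add_iff' 1).2 h.hasSum
  simpa using h2

theorem add_one_le_aperyCoeff {n k : ℕ} (h : k < n) : (n : ℝ) + 1 ≤ aperyCoeff n (k + 1) := by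
  have h1 : 1 ≤ n.choose (k + 1) := Nat.choose_pos h
  have h2 : n + 1 ≤ (n + (k + 1)).choose (k + 1) := by
    calc n + 1 = (n + 1).choose n := by simp
      _ ≤ (n + (k + 1)).choose n := Nat.choose_le_choose n (by omega)
      _ = _ := Nat.choose_symm_add
  unfold aperyCoeff
  have := Nat.mul_le_mul h1 h2
  rw [one_mul] at this
  exact_mod_cast this

theorem abs_aperyC_sub_le {n k : ℕ} (h : k ≤ n) :
    |aperyC n k - ∑ m ∈ Finset.range n, 1 / ((m : ℝ) + 1) ^ 3| ≤
      (∑' k : ℕ, 1 / (k : ℝ) ^ 3) / ((n : ℝ) + 1) := by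
  unfold aperyC
  rw [add_sub_cancel_left]
  calc _ ≤ ∑ m ∈ Finset.range k,
        |(-1) ^ m / (2 * ((m : ℝ) + 1) ^ 3 * aperyCoeff n (m + 1))| :=
      Finset.abs_sum_le_sum_abs _ _
    _ ≤ ∑ m ∈ Finset.range k, 1 / ((m : ℝ) + 1) ^ 3 / ((n : ℝ) + 1) := by
      refine Finset.sum_le_sum fun m hm ↦ ?_
      have h1 := add_one_le_aperyCoeff (show m < n by have := Finset.mem_range.1 hm; omega)
      have h0 : (0 : ℝ) < (n : ℝ) + 1 := by positivity
      have h2 := h0.trans_le h1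
      rw [abs_div, abs_pow, abs_neg, abs_one, one_pow, abs_of_pos (by positivity), div_div]
      apply one_div_le_one_div_of_le (by positivity)
      apply mul_le_mul _ h1 h0.le (by positivity)
      have : (0 : ℝ) < ((m : ℝ) + 1) ^ 3 := by positivity
      linarith
    _ = (∑ m ∈ Finset.range k, 1 / ((m : ℝ) + 1) ^ 3) / ((n : ℝ) + 1) := by
      rw [Finset.sum_div]
    _ ≤ _ := by
      gcongr
      exact sum_le_hasSum _ (fun i _ ↦ by positivity) hasSum_zeta_three

theorem abs_aperyB_div_sub_le (n : ℕ) :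
    |aperyB n / aperyA n - ∑ m ∈ Finset.range n, 1 / ((m : ℝ) + 1) ^ 3| ≤
      (∑' k : ℕ, 1 / (k : ℝ) ^ 3) / ((n : ℝ) + 1) := by
  have hA := aperyA_pos n
  set H := ∑ m ∈ Finset.range n, 1 / ((m : ℝ) + 1) ^ 3 with hH
  rw [div_sub' hA.ne', abs_div, abs_of_pos hA, div_le_iff₀ hA]
  calc |aperyB n - aperyA n * H|
      = |∑ k ∈ Finset.range (n + 1), aperyCoeff n k ^ 2 * (aperyC n k - H)| := by
        rw [aperyA, aperyB, Finset.sum_mul, ← Finset.sum_sub_distrib]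
        simp only [mul_sub]
    _ ≤ ∑ k ∈ Finset.range (n + 1), |aperyCoeff n k ^ 2 * (aperyC n k - H)| :=
        Finset.abs_sum_le_sum_abs _ _
    _ ≤ ∑ k ∈ Finset.range (n + 1),
          aperyCoeff n k ^ 2 * ((∑' k : ℕ, 1 / (k : ℝ) ^ 3) / ((n : ℝ) + 1)) := by
        refine Finset.sum_le_sum fun k hk ↦ ?_
        rw [abs_mul, abs_of_nonneg (sq_nonneg _)]
        exact mul_le_mul_of_nonneg_left
          (abs_aperyC_sub_le (Nat.lt_succ_iff.1 (Finset.mem_range.1 hk))) (sq_nonneg _)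
    _ = _ := by rw [← Finset.sum_mul, aperyA, mul_comm]

theorem tendsto_aperyB_div_aperyA :
    Tendsto (fun n ↦ aperyB n / aperyA n) atTop (𝓝 (∑' k : ℕ, 1 / (k : ℝ) ^ 3)) := by
  have h1 := hasSum_zeta_three.tendsto_sum_nat
  have h2 : Tendsto (fun n : ℕ ↦ (∑' k : ℕ, 1 / (k : ℝ) ^ 3) / ((n : ℝ) + 1)) atTop (𝓝 0) := by
    have := tendsto_one_div_add_atTop_nhds_zero_nat (𝕜 := ℝ)
    simpa only [mul_one_div, mul_zero] using this.const_mul (∑' k : ℕ, 1 / (k : ℝ) ^ 3)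
  have h3 := (squeeze_zero_norm abs_aperyB_div_sub_le h2).add h1
  simpa using h3

theorem aperyB_div_succ_sub (n : ℕ) :
    aperyB (n + 1) / aperyA (n + 1) - aperyB n / aperyA n =
      6 / (((n : ℝ) + 1) ^ 3 * (aperyA n * aperyA (n + 1))) := by
  have h0 := (aperyA_pos n).ne'
  have h1 := (aperyA_pos (n + 1)).ne'
  rw [div_sub_div _ _ h1 h0, apery_casoratian, div_div, mul_comm (aperyA n)]

theorem aperyB_lt_mul (n : ℕ) : aperyB n < (∑' k : ℕ, 1 / (k : ℝ) ^ 3) * aperyA n := by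
  have hlt (n : ℕ) : aperyB n / aperyA n < aperyB (n + 1) / aperyA (n + 1) := by
    rw [← sub_pos, aperyB_div_succ_sub]
    have h0 := aperyA_pos n
    have h1 := aperyA_pos (n + 1)
    positivity
  have hmono := strictMono_nat_of_lt_succ hlt
  rw [← div_lt_iff₀ (aperyA_pos n)]
  exact (hlt n).trans_le (hmono.monotone.ge_of_tendsto tendsto_aperyB_div_aperyA (n + 1))

theorem mul_sub_aperyB_le (n : ℕ) :
    (∑' k : ℕ, 1 / (k : ℝ) ^ 3) * aperyA n - aperyB n ≤ 8 / aperyA n := by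
  have hanti : Antitone fun n ↦ aperyB n / aperyA n + 8 / aperyA n ^ 2 := by
    refine antitone_nat_of_succ_le fun n ↦ ?_
    have h := aperyB_div_succ_sub n
    have h0 := aperyA_pos n
    have h1 := aperyA_pos (n + 1)
    have h2 := two_mul_aperyA_le n
    have h3 : 6 / (((n : ℝ) + 1) ^ 3 * (aperyA n * aperyA (n + 1))) ≤
        6 / (aperyA n * aperyA (n + 1)) := by
      apply div_le_div_of_nonneg_left (by norm_num) (by positivity)
      apply le_mul_of_one_le_left (by positivity)
      exact one_le_pow₀ (by have : (0 : ℝ) ≤ n := by positivity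
                            linarith)
    have h4 : 6 / (aperyA n * aperyA (n + 1)) ≤ 8 / aperyA n ^ 2 - 8 / aperyA (n + 1) ^ 2 := by
      rw [div_sub_div _ _ (by positivity) (by positivity),
        div_le_div_iff₀ (by positivity) (by positivity)]
      have : 6 * (aperyA n * aperyA (n + 1)) ≤ 8 * aperyA (n + 1) ^ 2 - 8 * aperyA n ^ 2 := by
        nlinarith
      have h5 : 0 < aperyA n * aperyA (n + 1) := by positivity
      nlinarith
    linarith
  have hle : (∑' k : ℕ, 1 / (k : ℝ) ^ 3) ≤ aperyB n / aperyA n + 8 / aperyA n ^ 2 := by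
    refine le_of_tendsto tendsto_aperyB_div_aperyA (eventually_atTop.2 ⟨n, fun m hm ↦ ?_⟩)
    refine le_trans ?_ (hanti hm)
    have := aperyA_pos m
    simp only [le_add_iff_nonneg_right]
    positivity
  have h0 := aperyA_pos n
  have := mul_le_mul_of_nonneg_right hle h0.le
  have e : (aperyB n / aperyA n + 8 / aperyA n ^ 2) * aperyA n = aperyB n + 8 / aperyA n := by
    field_simp
  linarith

/-- `m C(n, m)` divides every common multiple of `1, …, n`, where `n = m + i`. -/
theorem mul_choose_dvd {D : ℕ} (i m : ℕ) (hm : 1 ≤ m) (hD : ∀ j, 1 ≤ j → j ≤ m + i → j ∣ D) :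
    m * (m + i).choose m ∣ D := by
  suffices h : ∃ z : ℤ, (D : ℝ) = z * (m * (m + i).choose m) by
    obtain ⟨z, hz⟩ := h
    have hz' : (D : ℤ) = z * ((m * (m + i).choose m : ℕ) : ℤ) := by exact_mod_cast hz
    exact Int.natCast_dvd_natCast.1 ⟨z, by rw [hz', mul_comm]⟩
  induction i generalizing m with
  | zero =>
    obtain ⟨c, hc⟩ := hD m hm (by omega)
    exact ⟨c, by rw [hc]; push_cast; simp [mul_comm]⟩
  | succ i ih =>
    obtain ⟨y, hy⟩ := ih m hm fun j h1 h2 ↦ hD j h1 (by omega)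
    obtain ⟨z, hz⟩ := ih (m + 1) (by omega) fun j h1 h2 ↦ hD j h1 (by omega)
    refine ⟨y - z, ?_⟩
    have e1 := choose_succ_left_mul (m + i) m
    have e2 := choose_succ_succ_mul (m + i) m
    rw [show m + 1 + i = m + i + 1 by ring] at hz
    rw [← add_assoc]
    push_cast at *
    have hm0 : (0 : ℝ) < m := by exact_mod_cast hm
    have hX : ((m + i).choose m : ℝ) ≠ 0 := by
      exact_mod_cast (Nat.choose_pos (show m ≤ m + i by omega)).ne'
    have hi : (i : ℝ) + 1 ≠ 0 := by positivity
    have hmi : (m : ℝ) + i + 1 ≠ 0 := by positivity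
    have e1' : ((m + i + 1).choose m : ℝ) =
        (m + i).choose m * ((m : ℝ) + i + 1) / ((i : ℝ) + 1) := by
      rw [eq_div_iff hi]; linear_combination e1
    have hz' : (D : ℝ) = z * ((m + i).choose m * ((m : ℝ) + i + 1)) := by
      rw [hz]; linear_combination (z : ℝ) * e2
    rw [e1']
    have hy' : (y : ℝ) = D / (m * (m + i).choose m) := by
      rw [eq_div_iff (by positivity), hy]
    have hz'' : (z : ℝ) = D / ((m + i).choose m * ((m : ℝ) + i + 1)) := by
      rw [eq_div_iff (by positivity), hz']
    rw [hy', hz'']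
    field_simp
    ring

theorem mul_choose_dvd_lcmUpto {n k m : ℕ} (hm : 1 ≤ m) (hmk : m ≤ k) (hkn : k ≤ n) :
    m * k.choose m ∣ Nat.lcmUpto n := by
  obtain ⟨i, rfl⟩ := Nat.exists_eq_add_of_le hmk
  exact mul_choose_dvd i m hm fun j h1 h2 ↦
    Finset.dvd_lcm (f := id) (Finset.mem_Icc.2 ⟨h1, h2.trans hkn⟩)

theorem aperyCoeff_eq_mul_div {n k m : ℕ} (hmk : m ≤ k) (hkn : k ≤ n) :
    aperyCoeff n k * (n.choose m * k.choose m) =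
      n.choose k * (n + k).choose (k - m) * aperyCoeff n m := by
  have key : (n + k).choose k * k.choose m = (n + k).choose (k - m) * (n + m).choose m := by
    have h := Nat.choose_mul (n := n + k) (show k - m ≤ k by omega)
    rw [Nat.choose_symm hmk] at h
    rw [h]
    congr 2 <;> omega
  unfold aperyCoeff
  have key' : ((n + k).choose k : ℝ) * k.choose m =
    (n + k).choose (k - m) * (n + m).choose m := by exact_mod_cast key
  linear_combination (n.choose k : ℝ) * n.choose m * key'

theorem exists_int_lcmUpto_mul_aperyB (n : ℕ) :
    ∃ z : ℤ, 2 * (Nat.lcmUpto n : ℝ) ^ 3 * aperyB n = z := by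
  set R := (Int.castRingHom ℝ).range with hR
  suffices h : 2 * (Nat.lcmUpto n : ℝ) ^ 3 * aperyB n ∈ R by
    obtain ⟨z, hz⟩ := h
    exact ⟨z, hz.symm⟩
  have hnat (m : ℕ) : (m : ℝ) ∈ R := ⟨m, by simp⟩
  have hcoeff (k : ℕ) : aperyCoeff n k ∈ R := mul_mem (hnat _) (hnat _)
  rw [aperyB, Finset.mul_sum]
  refine sum_mem fun k hk ↦ ?_
  have hk : k ≤ n := Nat.lt_succ_iff.1 (Finset.mem_range.1 hk)
  rw [aperyC, mul_add, mul_add, Finset.mul_sum, Finset.mul_sum, Finset.mul_sum, Finset.mul_sum]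
  refine add_mem (sum_mem fun m hm ↦ ?_) (sum_mem fun m hm ↦ ?_)
  · obtain ⟨c, hc⟩ := mul_choose_dvd_lcmUpto (show 1 ≤ m + 1 by omega) le_rfl
      (show m + 1 ≤ n by have := Finset.mem_range.1 hm; omega)
    have e : 2 * (Nat.lcmUpto n : ℝ) ^ 3 * (aperyCoeff n k ^ 2 * (1 / ((m : ℝ) + 1) ^ 3)) =
        (2 : ℕ) * (c : ℝ) ^ 3 * aperyCoeff n k ^ 2 := by
      rw [hc]; push_cast [Nat.choose_self]
      have : (m : ℝ) + 1 ≠ 0 := by positivity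
      field_simp
    rw [e]
    exact mul_mem (mul_mem (hnat _) (pow_mem (hnat _) _)) (pow_mem (hcoeff _) _)
  · have hm : m + 1 ≤ k := Finset.mem_range.1 hm
    obtain ⟨c₁, h1⟩ := mul_choose_dvd_lcmUpto (show 1 ≤ m + 1 by omega) le_rfl (hm.trans hk)
    obtain ⟨c₂, h2⟩ := mul_choose_dvd_lcmUpto (show 1 ≤ m + 1 by omega) hm hk
    obtain ⟨c₃, h3⟩ := mul_choose_dvd_lcmUpto (show 1 ≤ m + 1 by omega) (hm.trans hk) le_rfl
    have h1' : (Nat.lcmUpto n : ℝ) = (m + 1) * c₁ := by rw [h1]; push_cast [Nat.choose_self]; ring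
    have h2' : (Nat.lcmUpto n : ℝ) = (m + 1) * k.choose (m + 1) * c₂ := by rw [h2]; push_cast; ring
    have h3' : (Nat.lcmUpto n : ℝ) = (m + 1) * n.choose (m + 1) * c₃ := by rw [h3]; push_cast; ring
    have h4 := aperyCoeff_eq_mul_div hm hk
    have hp := (aperyCoeff_pos (hm.trans hk)).ne'
    have e : 2 * (Nat.lcmUpto n : ℝ) ^ 3 * (aperyCoeff n k ^ 2 *
        ((-1) ^ m / (2 * ((m : ℝ) + 1) ^ 3 * aperyCoeff n (m + 1)))) =
        (c₁ : ℝ) * c₂ * c₃ * ((n.choose k : ℕ) * ((n + k).choose (k - (m + 1)) : ℕ)) *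
          aperyCoeff n k * (-1) ^ m := by
      rw [show (Nat.lcmUpto n : ℝ) ^ 3 = (m + 1) * c₁ * ((m + 1) * k.choose (m + 1) * c₂) *
        ((m + 1) * n.choose (m + 1) * c₃) by rw [← h1', ← h2', ← h3']; ring]
      have : (m : ℝ) + 1 ≠ 0 := by positivity
      rw [mul_div_assoc', mul_div_assoc', div_eq_iff (by positivity)]
      linear_combination 2 * ((m : ℝ) + 1) ^ 3 * c₁ * c₂ * c₃ * aperyCoeff n k * (-1) ^ m * h4
    rw [e]
    exact mul_mem (mul_mem (mul_mem (mul_mem (mul_mem (hnat _) (hnat _)) (hnat _))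
      (mul_mem (hnat _) (hnat _))) (hcoeff _)) (pow_mem (neg_mem (one_mem _)) _)

theorem exists_int_aperyA (n : ℕ) : ∃ z : ℤ, aperyA n = z :=
  ⟨∑ k ∈ Finset.range (n + 1), ((n.choose k * (n + k).choose k : ℕ) : ℤ) ^ 2, by
    simp [aperyA, aperyCoeff]⟩

/-- The real number `ζ(3) = Σ_{k≥1} 1/k³` is irrational.
(The `k = 0` term of the `tsum` vanishes since `1/0 = 0` in Lean.) -/
theorem irrational_zeta_three :
    Irrational (∑' k : ℕ, 1 / (k : ℝ) ^ 3) := by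
  rintro ⟨r, hr⟩
  set q := r.den with hq
  have hq0 : (0 : ℝ) < q := by exact_mod_cast r.den_pos
  set n := 1764 * q with hn
  obtain ⟨x, hx⟩ := exists_int_aperyA n
  obtain ⟨y, hy⟩ := exists_int_lcmUpto_mul_aperyB n
  have hlt := aperyB_lt_mul n
  have hle := mul_sub_aperyB_le n
  have hA := aperyA_pos n
  have hrq : (r : ℝ) * q = r.num := by exact_mod_cast Rat.mul_den_eq_num r
  rw [← hr] at hlt hle
  set d := Nat.lcmUpto n with hd
  have hd0 : (0 : ℝ) < d := by exact_mod_cast Nat.lcmUpto_pos n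
  have hint : 2 * q * (d : ℝ) ^ 3 * (r * aperyA n - aperyB n) =
      ((2 * d ^ 3 * r.num * x - q * y : ℤ) : ℝ) := by
    push_cast
    rw [← hrq, ← hx, ← hy]; ring
  have hpos : 0 < 2 * q * (d : ℝ) ^ 3 * (r * aperyA n - aperyB n) :=
    mul_pos (by positivity) (by linarith)
  have hone : 1 ≤ 2 * q * (d : ℝ) ^ 3 * (r * aperyA n - aperyB n) := by
    rw [hint] at hpos ⊢
    exact_mod_cast Int.cast_pos.1 hpos
  have h1 : 1 ≤ 2 * q * (d : ℝ) ^ 3 * (8 / aperyA n) :=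
    hone.trans (mul_le_mul_of_nonneg_left hle (by positivity))
  rw [mul_div_assoc', le_div_iff₀ hA, one_mul] at h1
  have h2 : (d : ℝ) ^ 3 ≤ 2 ^ (8541 * q) := by exact_mod_cast lcmUpto_cube_le q
  have h3 := two_pow_le_aperyA n
  have h4 : (q : ℝ) < 2 ^ q := by exact_mod_cast Nat.lt_two_pow_self
  have h5 : (2 : ℝ) ^ (5 * n) < 2 ^ (239 + q + 8541 * q) := by
    calc (2 : ℝ) ^ (5 * n) ≤ 2 ^ 235 * (2 * q * (d : ℝ) ^ 3 * 8) := by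
          exact h3.trans (mul_le_mul_of_nonneg_left h1 (by positivity))
      _ ≤ 2 ^ 235 * (2 * q * 2 ^ (8541 * q) * 8) := by gcongr
      _ < 2 ^ 235 * (2 * 2 ^ q * 2 ^ (8541 * q) * 8) := by gcongr
      _ = _ := by rw [pow_add, pow_add]; ring
  have h6 := (pow_lt_pow_iff_right₀ (by norm_num : (1 : ℝ) < 2)).1 h5
  have h7 : 0 < q := r.den_pos
  omega
end
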